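/- arXiv:1509.05752 — 3 statements merged into one kernel-verified Lean document; each statement's English description precedes it below -/
import Mathlib

section
/- Let n ≥ 2 and α, β > 0. For a tableau S of size n, let φ(S) denote the array of size n−1 defined by φ(S)(i,1) = S(i,1) for 1 ≤ i ≤ n−1 and φ(S)(i,j) = S(i,j+1) for j ≥ 2 with i+j ≤ n (i.e. delete the second column of S together with the last row). Then for every α/β-staircase tableau T of size n−1 whose box (n−1,1) contains β, one has ℙ_{n,α,β}({S : box (n−1,1) of S contains β and φ(S) = T}) · ℙ_{n−1,α,β}(box (n−1,1) contains β) = ℙ_{n−1,α,β}(T) · ℙ_{n,α,β}(box (n−1,1) contains β). In other words, conditioned on box (n−1,1) containing β, φ(S) is distributed as a random α/β-staircase tableau of size n−1 under ℙ_{n−1,α,β} conditioned on having β in box (n−1,1). -/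
open scoped BigOperators

/-- A symbol in an α/β-staircase tableau: empty, α, or β. -/
inductive StairSymb : Type
  | empty : StairSymb
  | alpha : StairSymb
  | beta  : StairSymb
  deriving DecidableEq

/-- `S` is an α/β-staircase tableau of size `n` (1-based indexing; boxes are the
pairs `(i,j)` with `1 ≤ i`, `1 ≤ j`, `i + j ≤ n + 1`; outside the boxes `S` is empty). -/
def IsStaircase (n : ℕ) (S : ℕ → ℕ → StairSymb) : Prop :=
  (∀ i j, ¬(1 ≤ i ∧ 1 ≤ j ∧ i + j ≤ n + 1) → S i j = StairSymb.empty) ∧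
  (∀ i i' j, 1 ≤ i → i < i' → 1 ≤ j → i' + j ≤ n + 1 →
    S i' j = StairSymb.alpha → S i j = StairSymb.empty) ∧
  (∀ i j j', 1 ≤ i → 1 ≤ j → j < j' → i + j' ≤ n + 1 →
    S i j' = StairSymb.beta → S i j = StairSymb.empty) ∧
  (∀ i j, 1 ≤ i → 1 ≤ j → i + j = n + 1 → S i j ≠ StairSymb.empty)

/-- The weight `wt(S) = α^{N_α(S)} β^{N_β(S)}` of a tableau. -/
noncomputable def stairWt (α β : ℝ) (S : ℕ → ℕ → StairSymb) : ℝ :=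
  α ^ Set.ncard {p : ℕ × ℕ | S p.1 p.2 = StairSymb.alpha} *
  β ^ Set.ncard {p : ℕ × ℕ | S p.1 p.2 = StairSymb.beta}

/-- The partition function `Z_n(α,β)`, the total weight of all tableaux of size `n`. -/
noncomputable def stairZ (n : ℕ) (α β : ℝ) : ℝ :=
  ∑ᶠ S ∈ {S : ℕ → ℕ → StairSymb | IsStaircase n S}, stairWt α β S

/-- The probability `ℙ_{n,α,β}(E)` of an event `E` (a set of tableaux of size `n`). -/
noncomputable def stairP (n : ℕ) (α β : ℝ) (E : (ℕ → ℕ → StairSymb) → Prop) : ℝ :=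
  (∑ᶠ S ∈ {S : ℕ → ℕ → StairSymb | IsStaircase n S ∧ E S}, stairWt α β S) / stairZ n α β

/-- The expectation `E_{n,α,β}[f]` of a real function of the random tableau. -/
noncomputable def stairE (n : ℕ) (α β : ℝ) (f : (ℕ → ℕ → StairSymb) → ℝ) : ℝ :=
  (∑ᶠ S ∈ {S : ℕ → ℕ → StairSymb | IsStaircase n S}, f S * stairWt α β S) / stairZ n α β

/-- The map `φ` deleting the second column and the last row of a size-`n` tableau,
producing an array of size `n−1` (empty outside the boxes of size `n−1`). -/
def stairPhi (n : ℕ) (S : ℕ → ℕ → StairSymb) : ℕ → ℕ → StairSymb :=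
  fun i j =>
    if 1 ≤ i ∧ 1 ≤ j ∧ i + j ≤ n then
      (if j = 1 then S i 1 else S i (j + 1))
    else StairSymb.empty

/-- The tableau of size `m + 1` obtained from a tableau `T` of size `m` with β in box `(m,1)` by
inserting a second column with a single α at the bottom, and a new last row containing β. -/
def stairInsert (m : ℕ) (T : ℕ → ℕ → StairSymb) : ℕ → ℕ → StairSymb :=
  fun i j =>
    if j ≤ 1 then (if i = m + 1 ∧ j = 1 then StairSymb.beta else T i j)
    else if j = 2 then (if i = m then StairSymb.alpha else StairSymb.empty)
    else T i (j - 1)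

/-- The position in `stairInsert m T` of a box of `T`. -/
def stairShift (p : ℕ × ℕ) : ℕ × ℕ := (p.1, if p.2 ≤ 1 then p.2 else p.2 + 1)

theorem stairShift_injective : Function.Injective stairShift := by
  rintro ⟨a, b⟩ ⟨c, d⟩ h
  simp only [stairShift, Prod.mk.injEq] at h ⊢
  grind

theorem IsStaircase.mem_of_ne_empty {m : ℕ} {T : ℕ → ℕ → StairSymb} (hT : IsStaircase m T)
    {i j : ℕ} (h : T i j ≠ StairSymb.empty) : 1 ≤ i ∧ 1 ≤ j ∧ i + j ≤ m + 1 := by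
  by_contra hc
  exact h (hT.1 i j hc)

theorem IsStaircase.finite_setOf_eq {m : ℕ} {T : ℕ → ℕ → StairSymb} (hT : IsStaircase m T)
    {s : StairSymb} (hs : s ≠ StairSymb.empty) : {p : ℕ × ℕ | T p.1 p.2 = s}.Finite := by
  refine (Set.finite_Iic (m + 1, m + 1)).subset fun p hp => ?_
  have h := hT.mem_of_ne_empty (i := p.1) (j := p.2) (by rw [Set.mem_ofPred_eq.mp hp]; exact hs)
  simp only [Set.mem_Iic, Prod.le_def]
  omega

theorem IsStaircase.stairInsert {m : ℕ} {T : ℕ → ℕ → StairSymb}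
    (hT : IsStaircase m T) (hTb : T m 1 = StairSymb.beta) :
    IsStaircase (m + 1) (stairInsert m T) := by
  obtain ⟨h0, h1, h2, h3⟩ := hT
  refine ⟨fun i j h => ?_, fun i i' j hi hii hj hb h => ?_, fun i j j' hi hj hjj hb h => ?_,
    fun i j hi hj h => ?_⟩
  · have := h0 i j
    have := h0 i (j - 1)
    clear h0 h1 h2 h3
    grind [_root_.stairInsert]
  · have := h1 i i' j
    have := h1 i i' (j - 1)
    clear h0 h1 h2 h3
    grind [_root_.stairInsert]
  · have := h2 i j j'
    have := h2 i j (j' - 1)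
    have := h2 i (j - 1) (j' - 1)
    clear h0 h1 h2 h3
    grind [_root_.stairInsert]
  · have := h3 i (j - 1)
    grind [_root_.stairInsert]

theorem stairPhi_stairInsert {m : ℕ} {T : ℕ → ℕ → StairSymb} (hT : IsStaircase m T) :
    stairPhi (m + 1) (stairInsert m T) = T := by
  funext i j
  have := hT.1 i j
  grind [stairInsert, stairPhi]

theorem IsStaircase.stairPhi {m : ℕ} {S : ℕ → ℕ → StairSymb} (hS : IsStaircase (m + 1) S)
    (hSb : S m 1 = StairSymb.beta) : IsStaircase m (stairPhi (m + 1) S) := by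
  obtain ⟨h0, h1, h2, h3⟩ := hS
  refine ⟨fun i j h => ?_, fun i i' j hi hii hj hb h => ?_, fun i j j' hi hj hjj hb h => ?_,
    fun i j hi hj h => ?_⟩
  · grind [_root_.stairPhi]
  · have := h1 i i' j
    have := h1 i i' (j + 1)
    clear h0 h1 h2 h3
    grind [_root_.stairPhi]
  · have := h2 i j (j' + 1)
    have := h2 i (j + 1) (j' + 1)
    clear h0 h1 h2 h3
    grind [_root_.stairPhi]
  · have := h3 i (j + 1)
    grind [_root_.stairPhi]

theorem IsStaircase.stairInsert_stairPhi {m : ℕ} {S : ℕ → ℕ → StairSymb}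
    (hS : IsStaircase (m + 1) S) (hm : 1 ≤ m) (hSb : S m 1 = StairSymb.beta) :
    _root_.stairInsert m (_root_.stairPhi (m + 1) S) = S := by
  obtain ⟨h0, h1, h2, h3⟩ := hS
  have hlast : S (m + 1) 1 = StairSymb.beta := by
    have := h1 m (m + 1) 1 hm (by omega) le_rfl le_rfl
    have := h3 (m + 1) 1 (by omega) le_rfl rfl
    cases h : S (m + 1) 1 <;> simp_all
  have hcol : S m 2 = StairSymb.alpha := by
    have := h2 m 1 2 hm le_rfl (by omega) le_rfl
    have := h3 m 2 hm (by omega) rfl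
    cases h : S m 2 <;> simp_all
  funext i j
  have := h0 i j
  have := h1 i m 2
  clear h0 h1 h2 h3
  have : 2 < j → j - 1 + 1 = j := by omega
  grind [_root_.stairInsert, _root_.stairPhi]

theorem setOf_stairInsert_eq_alpha {m : ℕ} {T : ℕ → ℕ → StairSymb}
    (hT : IsStaircase m T) :
    {p : ℕ × ℕ | stairInsert m T p.1 p.2 = StairSymb.alpha} =
      insert (m, 2) (stairShift '' {p | T p.1 p.2 = StairSymb.alpha}) := by
  have hout := hT.1 (m + 1) 1 (by omega)
  ext ⟨i, j⟩
  simp only [Set.mem_ofPred_eq, Set.mem_insert_iff, Set.mem_image, Prod.exists, stairShift,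
    Prod.mk.injEq]
  constructor
  · intro h
    by_cases hj : j = 2
    · left
      grind [stairInsert]
    · right
      by_cases hj1 : j ≤ 1
      · exact ⟨i, j, by grind [stairInsert], rfl, by simp [hj1]⟩
      · exact ⟨i, j - 1, by grind [stairInsert], rfl, by grind⟩
  · rintro (⟨rfl, rfl⟩ | ⟨a, b, h, rfl, rfl⟩) <;> grind [stairInsert]

theorem setOf_stairInsert_eq_beta {m : ℕ} {T : ℕ → ℕ → StairSymb} :
    {p : ℕ × ℕ | stairInsert m T p.1 p.2 = StairSymb.beta} =
      insert (m + 1, 1) (stairShift '' {p | T p.1 p.2 = StairSymb.beta}) := by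
  ext ⟨i, j⟩
  simp only [Set.mem_ofPred_eq, Set.mem_insert_iff, Set.mem_image, Prod.exists, stairShift,
    Prod.mk.injEq]
  constructor
  · intro h
    by_cases hij : i = m + 1 ∧ j = 1
    · exact Or.inl hij
    · right
      by_cases hj1 : j ≤ 1
      · exact ⟨i, j, by grind [stairInsert], rfl, by simp [hj1]⟩
      · exact ⟨i, j - 1, by grind [stairInsert], rfl, by grind [stairInsert]⟩
  · rintro (⟨rfl, rfl⟩ | ⟨a, b, h, rfl, rfl⟩) <;> grind [stairInsert]

theorem stairWt_stairInsert {m : ℕ} {T : ℕ → ℕ → StairSymb} (hT : IsStaircase m T) (α β : ℝ) :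
    stairWt α β (stairInsert m T) = α * β * stairWt α β T := by
  have hout := hT.1 (m + 1) 1 (by omega)
  have ha : (m, 2) ∉ stairShift '' {p : ℕ × ℕ | T p.1 p.2 = StairSymb.alpha} := by
    rintro ⟨⟨a, b⟩, -, h⟩
    grind [stairShift]
  have hb : (m + 1, 1) ∉ stairShift '' {p : ℕ × ℕ | T p.1 p.2 = StairSymb.beta} := by
    rintro ⟨⟨a, b⟩, h', h⟩
    grind [stairShift]
  rw [stairWt, stairWt, setOf_stairInsert_eq_alpha hT, setOf_stairInsert_eq_beta,
    Set.ncard_insert_of_notMem ha ((hT.finite_setOf_eq (by simp)).image _),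
    Set.ncard_insert_of_notMem hb ((hT.finite_setOf_eq (by simp)).image _),
    Set.ncard_image_of_injective _ stairShift_injective,
    Set.ncard_image_of_injective _ stairShift_injective]
  ring

theorem bijOn_stairInsert {m : ℕ} (hm : 1 ≤ m) :
    Set.BijOn (stairInsert m) {T | IsStaircase m T ∧ T m 1 = StairSymb.beta}
      {S | IsStaircase (m + 1) S ∧ S m 1 = StairSymb.beta} := by
  refine ⟨fun T hT => ⟨hT.1.stairInsert hT.2, ?_⟩, fun T hT T' hT' h => ?_, fun S hS =>
    ⟨stairPhi (m + 1) S, ⟨hS.1.stairPhi hS.2, ?_⟩, hS.1.stairInsert_stairPhi hm hS.2⟩⟩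
  · simpa [stairInsert] using hT.2
  · rw [← stairPhi_stairInsert hT.1, h, stairPhi_stairInsert hT'.1]
  · simpa [stairPhi, hm] using hS.2

theorem finsum_mem_stairWt_beta_corner {m : ℕ} (hm : 1 ≤ m) (α β : ℝ) :
    ∑ᶠ S ∈ {S | IsStaircase (m + 1) S ∧ S m 1 = StairSymb.beta}, stairWt α β S =
      α * β * ∑ᶠ T ∈ {T | IsStaircase m T ∧ T m 1 = StairSymb.beta}, stairWt α β T := by
  rw [← finsum_mem_eq_of_bijOn (f := fun T => α * β * stairWt α β T) _ (bijOn_stairInsert hm)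
    fun T hT => (stairWt_stairInsert hT.1 α β).symm]
  simp only [← smul_eq_mul (α * β), smul_finsum]

/-- Conditioned on box `(n−1,1)` containing β, `φ(S)` is distributed as a random tableau
of size `n−1` conditioned on having β in box `(n−1,1)`. -/
theorem subtableau_given_beta_corner (n : ℕ) (hn : 2 ≤ n) (α β : ℝ) (hα : 0 < α) (hβ : 0 < β)
    (T : ℕ → ℕ → StairSymb) (hT : IsStaircase (n - 1) T)
    (hTb : T (n - 1) 1 = StairSymb.beta) :
    stairP n α β (fun S => S (n - 1) 1 = StairSymb.beta ∧ stairPhi n S = T) *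
      stairP (n - 1) α β (fun S => S (n - 1) 1 = StairSymb.beta)
    = stairP (n - 1) α β (fun S => S = T) *
      stairP n α β (fun S => S (n - 1) 1 = StairSymb.beta) := by
  obtain ⟨m, rfl⟩ : ∃ m, n = m + 1 := ⟨n - 1, by omega⟩
  have hm : 1 ≤ m := by omega
  simp only [Nat.add_sub_cancel] at hT hTb ⊢
  have hfib : {S | IsStaircase (m + 1) S ∧ S m 1 = StairSymb.beta ∧ stairPhi (m + 1) S = T} =
      {stairInsert m T} := by
    ext S
    constructor
    · rintro ⟨hS, hSb, rfl⟩
      exact (hS.stairInsert_stairPhi hm hSb).symm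
    · rintro rfl
      have h := (bijOn_stairInsert hm).mapsTo ⟨hT, hTb⟩
      exact ⟨h.1, h.2, stairPhi_stairInsert hT⟩
  have hsing : {S | IsStaircase m S ∧ S = T} = {T} := by
    ext S
    exact ⟨fun h => h.2, fun h => ⟨Set.mem_singleton_iff.mp h ▸ hT, h⟩⟩
  simp only [stairP]
  rw [hfib, hsing, finsum_mem_singleton, finsum_mem_singleton, stairWt_stairInsert hT,
    finsum_mem_stairWt_beta_corner hm]
  ring
end

section
/- Let n ≥ 3, let α, β > 0 with a = 1/α and b = 1/β, and let 1 ≤ k ≤ n−2. If S is an α/β-staircase tableau of size n such that box (n−k−1, k) is nonempty and at least one of the boxes (n−k−1, k+1), (n−k, k) is nonempty, then ℙ_{n,α,β}(S) ≤ 2 / ((n+a+b−2)(n+a+b−1)). -/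
open scoped BigOperators

namespace StairSymb

instance : Finite StairSymb :=
  Finite.of_surjective
    (fun o : Option Bool => o.elim empty fun b => if b then alpha else beta) (by
      rintro (_ | _ | _)
      exacts [⟨none, rfl⟩, ⟨some true, rfl⟩, ⟨some false, rfl⟩])

end StairSymb

namespace IsStaircase

variable {n : ℕ} {S : ℕ → ℕ → StairSymb}

theorem mem_box (hS : IsStaircase n S) {i j : ℕ} (h : S i j ≠ StairSymb.empty) :
    1 ≤ i ∧ 1 ≤ j ∧ i + j ≤ n + 1 := by
  by_contra hc
  exact h (hS.1 i j hc)

theorem finite_setOf (n : ℕ) : {S : ℕ → ℕ → StairSymb | IsStaircase n S}.Finite := by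
  let f : (ℕ → ℕ → StairSymb) → Fin (n + 2) → Fin (n + 2) → StairSymb :=
    fun S i j => S i j
  refine Set.Finite.of_finite_image (f := f) (Set.toFinite _) ?_
  intro S hS T hT h
  funext i j
  by_cases hb : 1 ≤ i ∧ 1 ≤ j ∧ i + j ≤ n + 1
  · exact congrFun (congrFun h ⟨i, by omega⟩) ⟨j, by omega⟩
  · rw [hS.1 i j hb, hT.1 i j hb]

theorem finite_setOf_eq_s12 (hS : IsStaircase n S) {s : StairSymb} (hs : s ≠ StairSymb.empty) :
    {p : ℕ × ℕ | S p.1 p.2 = s}.Finite := by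
  refine ((Finset.Icc 1 n ×ˢ Finset.Icc 1 n).finite_toSet).subset ?_
  rintro ⟨i, j⟩ (h : S i j = s)
  have := hS.mem_box (i := i) (j := j) (h ▸ hs)
  simp only [Finset.coe_product, Set.mem_prod, Finset.coe_Icc, Set.mem_Icc]
  omega

/-- Every column contains at most one `α`. -/
theorem injOn_snd_alpha (hS : IsStaircase n S) :
    Set.InjOn Prod.snd {p : ℕ × ℕ | S p.1 p.2 = StairSymb.alpha} := by
  rintro ⟨i, j⟩ (h : S i j = _) ⟨i', j'⟩ (h' : S i' j' = _) (rfl : j = j')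
  have hb := hS.mem_box (i := i) (j := j) (by simp [h])
  have hb' := hS.mem_box (i := i') (j := j) (by simp [h'])
  rcases lt_trichotomy i i' with hlt | rfl | hlt
  · simpa [h] using hS.2.1 i i' j hb.1 hlt hb.2.1 hb'.2.2 h'
  · rfl
  · simpa [h'] using hS.2.1 i' i j hb'.1 hlt hb.2.1 hb.2.2 h

/-- Every row contains at most one `β`. -/
theorem injOn_fst_beta (hS : IsStaircase n S) :
    Set.InjOn Prod.fst {p : ℕ × ℕ | S p.1 p.2 = StairSymb.beta} := by
  rintro ⟨i, j⟩ (h : S i j = _) ⟨i', j'⟩ (h' : S i' j' = _) (rfl : i = i')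
  have hb := hS.mem_box (i := i) (j := j) (by simp [h])
  have hb' := hS.mem_box (i := i) (j := j') (by simp [h'])
  rcases lt_trichotomy j j' with hlt | rfl | hlt
  · simpa [h] using hS.2.2.1 i j j' hb.1 hb.2.1 hlt hb'.2.2 h'
  · rfl
  · simpa [h'] using hS.2.2.1 i j' j hb.1 hb'.2.1 hlt hb.2.2 h

theorem ncard_alpha_le (hS : IsStaircase n S) :
    {p : ℕ × ℕ | S p.1 p.2 = StairSymb.alpha}.ncard ≤ n := by
  rw [← hS.injOn_snd_alpha.ncard_image]
  calc _ ≤ (↑(Finset.Icc 1 n) : Set ℕ).ncard := by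
        refine Set.ncard_le_ncard ?_ (Finset.finite_toSet _)
        rintro _ ⟨⟨i, j⟩, (h : S i j = _), rfl⟩
        have := hS.mem_box (i := i) (j := j) (by simp [h])
        simp only [Finset.coe_Icc, Set.mem_Icc]
        omega
    _ = n := by rw [Set.ncard_coe_finset]; simp

theorem ncard_beta_le (hS : IsStaircase n S) :
    {p : ℕ × ℕ | S p.1 p.2 = StairSymb.beta}.ncard ≤ n := by
  rw [← hS.injOn_fst_beta.ncard_image]
  calc _ ≤ (↑(Finset.Icc 1 n) : Set ℕ).ncard := by
        refine Set.ncard_le_ncard ?_ (Finset.finite_toSet _)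
        rintro _ ⟨⟨i, j⟩, (h : S i j = _), rfl⟩
        have := hS.mem_box (i := i) (j := j) (by simp [h])
        simp only [Finset.coe_Icc, Set.mem_Icc]
        omega
    _ = n := by rw [Set.ncard_coe_finset]; simp

/-- The first column contains an `α` only in a row without `β`. -/
theorem ncard_alpha_add_ncard_beta_lt (hS : IsStaircase n S) (hn : 1 ≤ n) :
    {p : ℕ × ℕ | S p.1 p.2 = StairSymb.alpha}.ncard +
      {p : ℕ × ℕ | S p.1 p.2 = StairSymb.beta}.ncard < 2 * n := by
  have hα := hS.ncard_alpha_le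
  have hβ := hS.ncard_beta_le
  by_cases hcol : ∃ i, S i 1 = StairSymb.alpha
  · obtain ⟨i, hi⟩ := hcol
    have hib := hS.mem_box (i := i) (j := 1) (by simp [hi])
    have : {p : ℕ × ℕ | S p.1 p.2 = StairSymb.beta}.ncard ≤ n - 1 := by
      rw [← hS.injOn_fst_beta.ncard_image]
      calc _ ≤ (↑((Finset.Icc 1 n).erase i) : Set ℕ).ncard := by
            refine Set.ncard_le_ncard ?_ (Finset.finite_toSet _)
            rintro _ ⟨⟨i', j⟩, (h : S i' j = _), rfl⟩
            have hb := hS.mem_box (i := i') (j := j) (by simp [h])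
            simp only [Finset.mem_coe, Finset.mem_erase, Finset.mem_Icc]
            refine ⟨?_, by omega⟩
            rintro rfl
            rcases hb.2.1.eq_or_lt with rfl | hj
            · simp [hi] at h
            · simpa [hi] using hS.2.2.1 i' 1 j hb.1 le_rfl hj hb.2.2 h
        _ = n - 1 := by
            rw [Set.ncard_coe_finset, Finset.card_erase_of_mem (by simp; omega)]
            simp
    omega
  · push Not at hcol
    have : {p : ℕ × ℕ | S p.1 p.2 = StairSymb.alpha}.ncard ≤ n - 1 := by
      rw [← hS.injOn_snd_alpha.ncard_image]
      calc _ ≤ (↑((Finset.Icc 1 n).erase 1) : Set ℕ).ncard := by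
            refine Set.ncard_le_ncard ?_ (Finset.finite_toSet _)
            rintro _ ⟨⟨i', j⟩, (h : S i' j = _), rfl⟩
            have hb := hS.mem_box (i := i') (j := j) (by simp [h])
            simp only [Finset.mem_coe, Finset.mem_erase, Finset.mem_Icc]
            refine ⟨?_, by omega⟩
            rintro rfl
            exact hcol i' h
        _ = n - 1 := by
            rw [Set.ncard_coe_finset, Finset.card_erase_of_mem (by simp; omega)]
            simp
    omega

/-- A tableau contains the main diagonal, so further nonempty boxes add to `n`. -/
theorem add_card_le_ncard_alpha_add_ncard_beta (hS : IsStaircase n S) (B : Finset (ℕ × ℕ))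
    (hB : ∀ p ∈ B, S p.1 p.2 ≠ StairSymb.empty ∧ p.1 + p.2 ≠ n + 1) :
    n + B.card ≤ {p : ℕ × ℕ | S p.1 p.2 = StairSymb.alpha}.ncard +
      {p : ℕ × ℕ | S p.1 p.2 = StairSymb.beta}.ncard := by
  have hα := hS.finite_setOf_eq_s12 (s := StairSymb.alpha) (by simp)
  have hβ := hS.finite_setOf_eq_s12 (s := StairSymb.beta) (by simp)
  rw [← Set.ncard_union_eq (Set.disjoint_left.2 fun p hp hq => by
    have h₁ : S p.1 p.2 = _ := hp
    have h₂ : S p.1 p.2 = _ := hq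
    simp [h₁] at h₂) hα hβ]
  have hD : Set.InjOn (fun i => (i, n + 1 - i)) (↑(Finset.Icc 1 n) : Set ℕ) :=
    fun _ _ _ _ h => congrArg Prod.fst h
  have hdisj : Disjoint ((Finset.Icc 1 n).image fun i => (i, n + 1 - i)) B := by
    rw [Finset.disjoint_left]
    rintro _ hp hq
    obtain ⟨i, hi, rfl⟩ := Finset.mem_image.1 hp
    have hi := Finset.mem_Icc.1 hi
    exact (hB _ hq).2 (show i + (n + 1 - i) = n + 1 by omega)
  calc n + B.card = (((Finset.Icc 1 n).image fun i => (i, n + 1 - i)) ∪ B).card := by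
        rw [Finset.card_union_of_disjoint hdisj, Finset.card_image_of_injOn hD]
        simp
    _ = (↑(((Finset.Icc 1 n).image fun i => (i, n + 1 - i)) ∪ B) : Set (ℕ × ℕ)).ncard :=
        (Set.ncard_coe_finset _).symm
    _ ≤ _ := by
        refine Set.ncard_le_ncard ?_ (hα.union hβ)
        intro p hp
        have hne : S p.1 p.2 ≠ StairSymb.empty := by
          rcases Finset.mem_union.1 (Finset.mem_coe.1 hp) with h | h
          · obtain ⟨i, hi, rfl⟩ := Finset.mem_image.1 h
            have hi := Finset.mem_Icc.1 hi
            exact hS.2.2.2 i (n + 1 - i) (by omega) (by omega) (by omega)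
          · exact (hB p h).1
        simp only [Set.mem_union, Set.mem_ofPred_eq]
        revert hne
        cases S p.1 p.2 <;> simp

end IsStaircase

/-! ### Adding a column on the left -/

open Classical in
/-- The rows of a tableau of size `n` that contain no `β`. -/
noncomputable def freeRows (n : ℕ) (S : ℕ → ℕ → StairSymb) : Finset ℕ :=
  (Finset.Icc 1 n).filter fun i => ∀ j, S i j ≠ StairSymb.beta

theorem mem_freeRows {n : ℕ} {S : ℕ → ℕ → StairSymb} {i : ℕ} :
    i ∈ freeRows n S ↔ (1 ≤ i ∧ i ≤ n) ∧ ∀ j, S i j ≠ StairSymb.beta := by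
  simp [freeRows]

/-- The column whose nonempty boxes are the rows in `V`, with `s` in the topmost of them and
`β` in all others. -/
def stairColumn (V : Finset ℕ) (s : StairSymb) (i : ℕ) : StairSymb :=
  if i ∈ V then if ∀ k ∈ V, i ≤ k then s else StairSymb.beta else StairSymb.empty

/-- Insert the column `c` to the left of `S`. -/
def consColumn (c : ℕ → StairSymb) (S : ℕ → ℕ → StairSymb) : ℕ → ℕ → StairSymb
  | _, 0 => StairSymb.empty
  | i, 1 => c i
  | i, j + 2 => S i (j + 1)

section Column

variable {V : Finset ℕ} {s : StairSymb} {m i : ℕ}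

theorem stairColumn_of_notMem (h : i ∉ V) : stairColumn V s i = StairSymb.empty := by
  simp [stairColumn, h]

theorem stairColumn_least (h : IsLeast (V : Set ℕ) m) : stairColumn V s m = s := by
  have h₂ : ∀ k ∈ V, m ≤ k := fun k hk => h.2 hk
  simp only [stairColumn, if_pos (Finset.mem_coe.1 h.1), if_pos h₂]

theorem stairColumn_of_mem_of_ne (h : IsLeast (V : Set ℕ) m) (hi : i ∈ V) (hne : i ≠ m) :
    stairColumn V s i = StairSymb.beta := by
  have : ¬ ∀ k ∈ V, i ≤ k := fun hc =>
    hne (le_antisymm (hc m (Finset.mem_coe.1 h.1)) (h.2 hi))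
  simp only [stairColumn, if_pos hi, if_neg this]

theorem stairColumn_ne_empty_iff (hs : s ≠ StairSymb.empty) :
    stairColumn V s i ≠ StairSymb.empty ↔ i ∈ V := by
  unfold stairColumn
  split_ifs <;> simp_all

theorem stairColumn_beta : stairColumn V StairSymb.beta i = StairSymb.beta ↔ i ∈ V := by
  unfold stairColumn
  split_ifs <;> simp_all

theorem stairColumn_beta_ne_alpha : stairColumn V StairSymb.beta i ≠ StairSymb.alpha := by
  unfold stairColumn
  split_ifs <;> simp

theorem stairColumn_eq_alpha_iff (h : IsLeast (V : Set ℕ) m) :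
    stairColumn V StairSymb.alpha i = StairSymb.alpha ↔ i = m := by
  constructor
  · intro hc
    by_contra hne
    by_cases hi : i ∈ V
    · simp [stairColumn_of_mem_of_ne h hi hne] at hc
    · simp [stairColumn_of_notMem hi] at hc
  · rintro rfl
    exact stairColumn_least h

theorem stairColumn_alpha_eq_beta_iff (h : IsLeast (V : Set ℕ) m) :
    stairColumn V StairSymb.alpha i = StairSymb.beta ↔ i ∈ V.erase m := by
  rw [Finset.mem_erase]
  constructor
  · intro hc
    refine ⟨?_, ?_⟩
    · rintro rfl
      simp [stairColumn_least h] at hc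
    · by_contra hi
      simp [stairColumn_of_notMem hi] at hc
  · exact fun ⟨hne, hi⟩ => stairColumn_of_mem_of_ne h hi hne

theorem exists_isLeast_insert (U : Finset ℕ) (k : ℕ) :
    ∃ m, IsLeast (↑(insert k U) : Set ℕ) m :=
  ⟨_, Finset.isLeast_min' _ (Finset.insert_nonempty k U)⟩

end Column

section Cons

variable {n : ℕ} {S : ℕ → ℕ → StairSymb} {U : Finset ℕ} {s : StairSymb}

theorem isStaircase_consColumn (hS : IsStaircase n S) (hU : U ⊆ freeRows n S)
    (hs : s ≠ StairSymb.empty) :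
    IsStaircase (n + 1) (consColumn (stairColumn (insert (n + 1) U) s) S) := by
  have hV : ∀ i ∈ insert (n + 1) U, 1 ≤ i ∧ i ≤ n + 1 := by
    intro i hi
    rcases Finset.mem_insert.1 hi with rfl | hi
    · omega
    · have := (mem_freeRows.1 (hU hi)).1
      omega
  obtain ⟨m, hm⟩ := exists_isLeast_insert U (n + 1)
  refine ⟨?_, ?_, ?_, ?_⟩
  · intro i j h
    match j with
    | 0 => rfl
    | 1 => exact stairColumn_of_notMem fun hi => h (by have := hV i hi; omega)
    | j + 2 => exact hS.1 i (j + 1) (by omega)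
  · intro i i' j hi hii' hj hb h
    match j, h with
    | 1, h =>
      refine stairColumn_of_notMem fun hiV => ?_
      by_cases hi' : i' ∈ insert (n + 1) U
      · have hmi := hm.2 hiV
        have := stairColumn_of_mem_of_ne (s := s) hm hi' (by omega)
        simp [consColumn, this] at h
      · simp [consColumn, stairColumn_of_notMem hi'] at h
    | j + 2, h => exact hS.2.1 i i' (j + 1) hi hii' (by omega) (by omega) h
  · intro i j j' hi hj hjj' hb h
    match j, j', h with
    | 1, j' + 2, h =>
      refine stairColumn_of_notMem fun hiV => ?_
      rcases Finset.mem_insert.1 hiV with rfl | hiU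
      · omega
      · exact (mem_freeRows.1 (hU hiU)).2 _ h
    | j + 2, j' + 2, h =>
      exact hS.2.2.1 i (j + 1) (j' + 1) hi (by omega) (by omega) (by omega) h
    | _ + 1, 1, _ => omega
  · intro i j hi hj h
    match j with
    | 1 =>
      obtain rfl : i = n + 1 := by omega
      exact (stairColumn_ne_empty_iff hs).2 (Finset.mem_insert_self _ _)
    | j + 2 => exact hS.2.2.2 i (j + 1) hi (by omega) (by omega)

theorem ncard_consColumn (hS : IsStaircase n S) {c : ℕ → StairSymb} {t : StairSymb}
    (ht : t ≠ StairSymb.empty) {C : Finset ℕ} (hC : ∀ i, c i = t ↔ i ∈ C) :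
    {p : ℕ × ℕ | consColumn c S p.1 p.2 = t}.ncard =
      {p : ℕ × ℕ | S p.1 p.2 = t}.ncard + C.card := by
  have hfin := hS.finite_setOf_eq_s12 ht
  have hinj : Function.Injective fun p : ℕ × ℕ => (p.1, p.2 + 1) := by
    rintro ⟨_, _⟩ ⟨_, _⟩ h
    simpa using h
  have hinj' : Function.Injective fun i : ℕ => (i, 1) := fun _ _ h => congrArg Prod.fst h
  have hset : {p : ℕ × ℕ | consColumn c S p.1 p.2 = t} =
      (fun p : ℕ × ℕ => (p.1, p.2 + 1)) '' {p : ℕ × ℕ | S p.1 p.2 = t} ∪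
        (fun i : ℕ => (i, 1)) '' (C : Set ℕ) := by
    ext ⟨i, j⟩
    simp only [Set.mem_ofPred_eq, Set.mem_union, Set.mem_image, Prod.exists, Prod.mk.injEq,
      Finset.mem_coe]
    constructor
    · intro h
      match j, h with
      | 0, h => exact absurd h.symm ht
      | 1, h => exact Or.inr ⟨i, (hC i).1 h, rfl, rfl⟩
      | j + 2, h => exact Or.inl ⟨i, j + 1, h, rfl, rfl⟩
    · rintro (⟨i, j, h, rfl, rfl⟩ | ⟨i, h, rfl, rfl⟩)
      · match j, h with
        | 0, h =>
          have := hS.mem_box (i := i) (j := 0) (h ▸ ht)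
          omega
        | j + 1, h => exact h
      · exact (hC i).2 h
  have hdisj : Disjoint ((fun p : ℕ × ℕ => (p.1, p.2 + 1)) '' {p : ℕ × ℕ | S p.1 p.2 = t})
      ((fun i : ℕ => (i, 1)) '' (C : Set ℕ)) := by
    rw [Set.disjoint_left]
    rintro _ ⟨⟨i, j⟩, (h : S i j = t), rfl⟩ ⟨i', -, h'⟩
    have := hS.mem_box (i := i) (j := j) (h ▸ ht)
    simp only [Prod.mk.injEq] at h'
    omega
  rw [hset, Set.ncard_union_eq hdisj (hfin.image _) (C.finite_toSet.image _),
    Set.ncard_image_of_injective _ hinj, Set.ncard_image_of_injective _ hinj',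
    Set.ncard_coe_finset]

theorem freeRows_consColumn (hS : IsStaircase n S) {c : ℕ → StairSymb} {C : Finset ℕ}
    (hC : ∀ i, c i = StairSymb.beta ↔ i ∈ C) :
    freeRows (n + 1) (consColumn c S) = insert (n + 1) (freeRows n S) \ C := by
  ext i
  simp only [Finset.mem_sdiff, Finset.mem_insert, mem_freeRows, ← hC]
  constructor
  · rintro ⟨hi, h⟩
    refine ⟨?_, h 1⟩
    by_cases hin : i = n + 1
    · exact Or.inl hin
    · refine Or.inr ⟨by omega, fun j hj => ?_⟩
      have := hS.mem_box (i := i) (j := j) (by simp [hj])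
      match j, hj with
      | 0, _ => omega
      | j + 1, hj => exact h (j + 2) hj
  · rintro ⟨hi, hc⟩
    refine ⟨by omega, fun j hj => ?_⟩
    match j, hj with
    | 0, hj => simp [consColumn] at hj
    | 1, hj => exact hc hj
    | j + 2, hj =>
      have hj : S i (j + 1) = StairSymb.beta := hj
      rcases hi with rfl | hi
      · have := hS.mem_box (i := n + 1) (j := j + 1) (by simp [hj])
        omega
      · exact hi.2 _ hj

theorem notMem_of_subset_freeRows (hU : U ⊆ freeRows n S) : n + 1 ∉ U := fun h => by
  have := (mem_freeRows.1 (hU h)).1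
  omega

variable (α β x : ℝ)

theorem weight_consColumn_beta (hS : IsStaircase n S) (hU : U ⊆ freeRows n S) :
    stairWt α β (consColumn (stairColumn (insert (n + 1) U) StairSymb.beta) S) *
        x ^ (freeRows (n + 1)
          (consColumn (stairColumn (insert (n + 1) U) StairSymb.beta) S)).card =
      stairWt α β S * β * (β ^ U.card * x ^ ((freeRows n S).card - U.card)) := by
  have hnU := notMem_of_subset_freeRows hU
  have hnF := notMem_of_subset_freeRows (Finset.Subset.refl (freeRows n S))
  have hβ : ∀ i, stairColumn (insert (n + 1) U) StairSymb.beta i = StairSymb.beta ↔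
      i ∈ insert (n + 1) U := fun _ => stairColumn_beta
  have hα : ∀ i, stairColumn (insert (n + 1) U) StairSymb.beta i = StairSymb.alpha ↔
      i ∈ (∅ : Finset ℕ) := fun _ => by simp [stairColumn_beta_ne_alpha]
  rw [freeRows_consColumn hS hβ, Finset.card_sdiff_of_subset (Finset.insert_subset_insert _ hU),
    Finset.card_insert_of_notMem hnU, Finset.card_insert_of_notMem hnF, stairWt,
    ncard_consColumn hS (by simp) hα, ncard_consColumn hS (by simp) hβ,
    Finset.card_insert_of_notMem hnU, Nat.add_sub_add_right, stairWt]
  simp only [Finset.card_empty, add_zero, pow_add, pow_one]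
  ring

theorem weight_consColumn_alpha (hS : IsStaircase n S) (hU : U ⊆ freeRows n S) :
    stairWt α β (consColumn (stairColumn (insert (n + 1) U) StairSymb.alpha) S) *
        x ^ (freeRows (n + 1)
          (consColumn (stairColumn (insert (n + 1) U) StairSymb.alpha) S)).card =
      stairWt α β S * (α * x) * (β ^ U.card * x ^ ((freeRows n S).card - U.card)) := by
  have hnU := notMem_of_subset_freeRows hU
  have hnF := notMem_of_subset_freeRows (Finset.Subset.refl (freeRows n S))
  obtain ⟨m, hm⟩ := exists_isLeast_insert U (n + 1)
  have hβ : ∀ i, stairColumn (insert (n + 1) U) StairSymb.alpha i = StairSymb.beta ↔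
      i ∈ (insert (n + 1) U).erase m := fun _ => stairColumn_alpha_eq_beta_iff hm
  have hα : ∀ i, stairColumn (insert (n + 1) U) StairSymb.alpha i = StairSymb.alpha ↔
      i ∈ ({m} : Finset ℕ) := fun _ => by rw [stairColumn_eq_alpha_iff hm, Finset.mem_singleton]
  have hcard : ((insert (n + 1) U).erase m).card = U.card := by
    rw [Finset.card_erase_of_mem (Finset.mem_coe.1 hm.1), Finset.card_insert_of_notMem hnU]
    simp
  have hle : U.card ≤ (freeRows n S).card := Finset.card_le_card hU
  rw [freeRows_consColumn hS hβ, Finset.card_sdiff_of_subset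
      ((Finset.erase_subset _ _).trans (Finset.insert_subset_insert _ hU)), hcard,
    Finset.card_insert_of_notMem hnF, stairWt,
    ncard_consColumn hS (by simp) hα, ncard_consColumn hS (by simp) hβ, hcard,
    Nat.sub_add_comm hle, stairWt]
  simp only [Finset.card_singleton, pow_add, pow_one]
  ring

theorem consColumn_injective {S' : ℕ → ℕ → StairSymb} {U' : Finset ℕ} {s' : StairSymb}
    (hS : IsStaircase n S) (hS' : IsStaircase n S')
    (hU : U ⊆ freeRows n S) (hU' : U' ⊆ freeRows n S')
    (hs : s ≠ StairSymb.empty) (hs' : s' ≠ StairSymb.empty)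
    (h : consColumn (stairColumn (insert (n + 1) U) s) S =
      consColumn (stairColumn (insert (n + 1) U') s') S') :
    S = S' ∧ U = U' ∧ s = s' := by
  have hcol : ∀ i, stairColumn (insert (n + 1) U) s i = stairColumn (insert (n + 1) U') s' i :=
    fun i => congrFun (congrFun h i) 1
  have hV : insert (n + 1) U = insert (n + 1) U' := by
    ext i
    rw [← stairColumn_ne_empty_iff hs, hcol, stairColumn_ne_empty_iff hs']
  refine ⟨?_, ?_, ?_⟩
  · funext i j
    match j with
    | 0 => rw [hS.1 i 0 (by omega), hS'.1 i 0 (by omega)]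
    | j + 1 => exact congrFun (congrFun h i) (j + 2)
  · rw [← Finset.erase_insert (notMem_of_subset_freeRows hU), hV,
      Finset.erase_insert (notMem_of_subset_freeRows hU')]
  · obtain ⟨m, hm⟩ := exists_isLeast_insert U (n + 1)
    have := hcol m
    rwa [stairColumn_least hm, stairColumn_least (hV ▸ hm)] at this

end Cons

/-- A finite family of tableaux of size `n` whose generating function, with `x` marking the rows
without `β`, is a product of linear factors. -/
theorem exists_staircases_sum_eq_prod (n : ℕ) (α β : ℝ) :
    ∃ A : Finset (ℕ → ℕ → StairSymb), (∀ S ∈ A, IsStaircase n S) ∧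
      ∀ x : ℝ, ∑ S ∈ A, stairWt α β S * x ^ (freeRows n S).card =
        ∏ i ∈ Finset.range n, (α * x + β + i * (α * β)) := by
  classical
  induction n with
  | zero =>
    refine ⟨{fun _ _ => StairSymb.empty}, ?_, ?_⟩
    · intro S hS
      rw [Finset.mem_singleton.1 hS]
      refine ⟨fun _ _ _ => rfl, fun _ _ _ _ _ _ _ _ => rfl, fun _ _ _ _ _ _ _ _ => rfl, ?_⟩
      intro i j _ _ _
      omega
    · intro x
      simp [stairWt, freeRows]
  | succ n ih =>
    obtain ⟨A, hA, hsum⟩ := ih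
    let D : Finset (Σ _ : (ℕ → ℕ → StairSymb), Finset ℕ × StairSymb) :=
      A.sigma fun S => (freeRows n S).powerset ×ˢ {StairSymb.alpha, StairSymb.beta}
    have hD : ∀ d ∈ D, IsStaircase n d.1 ∧ d.2.1 ⊆ freeRows n d.1 ∧
        d.2.2 ≠ StairSymb.empty := by
      rintro ⟨S, U, s⟩ hd
      simp only [D, Finset.mem_sigma, Finset.mem_product, Finset.mem_powerset,
        Finset.mem_insert, Finset.mem_singleton] at hd
      refine ⟨hA S hd.1, hd.2.1, ?_⟩
      rcases hd.2.2 with h | h <;> simp [h]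
    let Φ : (Σ _ : (ℕ → ℕ → StairSymb), Finset ℕ × StairSymb) → ℕ → ℕ → StairSymb :=
      fun d => consColumn (stairColumn (insert (n + 1) d.2.1) d.2.2) d.1
    have hΦ : Set.InjOn Φ D := by
      rintro ⟨S, U, s⟩ hd ⟨S', U', s'⟩ hd' h
      obtain ⟨h₁, h₂, h₃⟩ := hD _ hd
      obtain ⟨h₁', h₂', h₃'⟩ := hD _ hd'
      obtain ⟨rfl, rfl, rfl⟩ := consColumn_injective h₁ h₁' h₂ h₂' h₃ h₃' h
      rfl
    refine ⟨D.image Φ, ?_, fun x => ?_⟩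
    · intro S hS
      obtain ⟨d, hd, rfl⟩ := Finset.mem_image.1 hS
      obtain ⟨h₁, h₂, h₃⟩ := hD d hd
      exact isStaircase_consColumn h₁ h₂ h₃
    · rw [Finset.sum_image hΦ, Finset.sum_sigma]
      have hstep : ∀ S ∈ A, (∑ e ∈ (freeRows n S).powerset ×ˢ
          ({StairSymb.alpha, StairSymb.beta} : Finset StairSymb),
            stairWt α β (Φ ⟨S, e⟩) * x ^ (freeRows (n + 1) (Φ ⟨S, e⟩)).card) =
          (α * x + β) * (stairWt α β S * (x + β) ^ (freeRows n S).card) := by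
        intro S hS
        rw [Finset.sum_product, add_comm x β, ← Finset.sum_pow_mul_eq_add_pow, Finset.mul_sum,
          Finset.mul_sum]
        refine Finset.sum_congr rfl fun U hU => ?_
        have hU := Finset.mem_powerset.1 hU
        rw [Finset.sum_pair (by simp), weight_consColumn_alpha α β x (hA S hS) hU,
          weight_consColumn_beta α β x (hA S hS) hU]
        ring
      rw [Finset.sum_congr rfl hstep, ← Finset.mul_sum, hsum, Finset.prod_range_succ']
      rw [mul_comm]
      congr 1
      · refine Finset.prod_congr rfl fun i _ => ?_
        push_cast
        ring
      · simp

theorem stairWt_nonneg {α β : ℝ} (hα : 0 ≤ α) (hβ : 0 ≤ β) (S : ℕ → ℕ → StairSymb) :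
    0 ≤ stairWt α β S := by
  unfold stairWt
  positivity

theorem prod_le_stairZ (n : ℕ) {α β : ℝ} (hα : 0 ≤ α) (hβ : 0 ≤ β) :
    ∏ i ∈ Finset.range n, (α + β + i * (α * β)) ≤ stairZ n α β := by
  obtain ⟨A, hA, hsum⟩ := exists_staircases_sum_eq_prod n α β
  have h := hsum 1
  simp only [one_pow, mul_one] at h
  rw [← h, stairZ, finsum_mem_eq_finite_toFinset_sum _ (IsStaircase.finite_setOf n)]
  refine Finset.sum_le_sum_of_subset_of_nonneg ?_ fun S _ _ => stairWt_nonneg hα hβ S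
  intro S hS
  simpa using hA S hS

theorem pow_le_prod_range_add {s : ℝ} (hs : 0 < s) {t m : ℕ} (ht : 1 ≤ t) (htm : t ≤ m) :
    s ^ t ≤ ∏ i ∈ Finset.range m, (s + i) := by
  induction m generalizing t with
  | zero => omega
  | succ m ih =>
    rw [Finset.prod_range_succ]
    rcases htm.eq_or_lt with rfl | hlt
    · rcases Nat.eq_zero_or_pos m with rfl | hm
      · simp
      · rw [pow_succ]
        exact mul_le_mul (ih hm le_rfl) (by simp) hs.le
          (Finset.prod_nonneg fun i _ => by positivity)
    · have hm : (1 : ℝ) ≤ m := by exact_mod_cast (by omega : 1 ≤ m)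
      calc s ^ t ≤ ∏ i ∈ Finset.range m, (s + i) := ih ht (by omega)
        _ ≤ _ := le_mul_of_one_le_right (Finset.prod_nonneg fun i _ => by positivity)
          (by linarith)

theorem pow_mul_pow_le_of_counts {α β : ℝ} (hα : 0 < α) (hβ : 0 < β) {m p q : ℕ}
    (hp : p ≤ m + 2) (hq : q ≤ m + 2) (hlt : p + q < 2 * (m + 2)) (hge : m + 4 ≤ p + q) :
    α ^ p * β ^ q * ((1 / α + 1 / β + m) * (1 / α + 1 / β + (m + 1))) ≤
      ∏ i ∈ Finset.range (m + 2), (α + β + i * (α * β)) := by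
  obtain ⟨u, hu⟩ := Nat.exists_eq_add_of_le hp
  obtain ⟨v, hv⟩ := Nat.exists_eq_add_of_le hq
  have hs : 0 < 1 / α + 1 / β := by positivity
  have hprod : ∏ i ∈ Finset.range (m + 2), (α + β + i * (α * β)) =
      (α * β) ^ (m + 2) * ∏ i ∈ Finset.range (m + 2), (1 / α + 1 / β + (i : ℝ)) := by
    rw [← Finset.card_range (m + 2), ← Finset.prod_const, Finset.card_range,
      ← Finset.prod_mul_distrib]
    refine Finset.prod_congr rfl fun i _ => ?_
    field_simp
    ring
  have hpow : α ^ p * β ^ q = (α * β) ^ (m + 2) * ((1 / α) ^ u * (1 / β) ^ v) := by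
    have h₁ : α ^ (m + 2) = α ^ p * α ^ u := by rw [hu, pow_add]
    have h₂ : β ^ (m + 2) = β ^ q * β ^ v := by rw [hv, pow_add]
    rw [mul_pow, h₁, h₂, one_div_pow, one_div_pow]
    field_simp
  have hle : (1 / α) ^ u * (1 / β) ^ v ≤ ∏ i ∈ Finset.range m, (1 / α + 1 / β + (i : ℝ)) :=
    calc (1 / α) ^ u * (1 / β) ^ v ≤ (1 / α + 1 / β) ^ u * (1 / α + 1 / β) ^ v := by
          have h₁ : 1 / α ≤ 1 / α + 1 / β := le_add_of_nonneg_right (by positivity)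
          have h₂ : 1 / β ≤ 1 / α + 1 / β := le_add_of_nonneg_left (by positivity)
          gcongr
      _ = (1 / α + 1 / β) ^ (u + v) := (pow_add _ _ _).symm
      _ ≤ _ := pow_le_prod_range_add hs (by omega) (by omega)
  rw [hprod, hpow, Finset.prod_range_succ, Finset.prod_range_succ, mul_assoc,
    mul_assoc (∏ i ∈ Finset.range m, _)]
  push_cast
  gcongr

/-- If box `(n−k−1, k)` on the third main diagonal is nonempty together with one of its
neighbours `(n−k−1, k+1)` or `(n−k, k)`, then the tableau has probability at most
`2/((n+a+b−2)(n+a+b−1))`. -/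
theorem prob_bound_third_diagonal_neighbours
    (n : ℕ) (hn : 3 ≤ n) (α β : ℝ) (hα : 0 < α) (hβ : 0 < β)
    (k : ℕ) (hk1 : 1 ≤ k) (hk2 : k ≤ n - 2)
    (S : ℕ → ℕ → StairSymb) (hS : IsStaircase n S)
    (h1 : S (n - k - 1) k ≠ StairSymb.empty)
    (h2 : S (n - k - 1) (k + 1) ≠ StairSymb.empty ∨ S (n - k) k ≠ StairSymb.empty) :
    stairP n α β (fun S' => S' = S)
      ≤ 2 / (((n : ℝ) + 1/α + 1/β - 2) * ((n : ℝ) + 1/α + 1/β - 1)) := by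
  have hcount : n + 2 ≤ {p : ℕ × ℕ | S p.1 p.2 = StairSymb.alpha}.ncard +
      {p : ℕ × ℕ | S p.1 p.2 = StairSymb.beta}.ncard := by
    rcases h2 with h2 | h2
    · have := hS.add_card_le_ncard_alpha_add_ncard_beta {(n - k - 1, k), (n - k - 1, k + 1)} (by
        intro p hp
        rcases Finset.mem_insert.1 hp with rfl | hp
        · exact ⟨h1, by dsimp only; omega⟩
        · rw [Finset.mem_singleton.1 hp]
          exact ⟨h2, by dsimp only; omega⟩)
      rwa [Finset.card_pair (by simp)] at this
    · have := hS.add_card_le_ncard_alpha_add_ncard_beta {(n - k - 1, k), (n - k, k)} (by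
        intro p hp
        rcases Finset.mem_insert.1 hp with rfl | hp
        · exact ⟨h1, by dsimp only; omega⟩
        · rw [Finset.mem_singleton.1 hp]
          exact ⟨h2, by dsimp only; omega⟩)
      rwa [Finset.card_pair (by simp only [ne_eq, Prod.mk.injEq]; omega)] at this
  have hset : {S' : ℕ → ℕ → StairSymb | IsStaircase n S' ∧ S' = S} = {S} := by
    ext S'
    simp only [Set.mem_ofPred_eq, Set.mem_singleton_iff]
    exact ⟨fun h => h.2, fun h => ⟨h ▸ hS, h⟩⟩
  have hpα := hS.ncard_alpha_le
  have hpβ := hS.ncard_beta_le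
  have hlt := hS.ncard_alpha_add_ncard_beta_lt (by omega)
  have hZ := prod_le_stairZ n hα.le hβ.le
  have hpos : 0 < ∏ i ∈ Finset.range n, (α + β + i * (α * β)) :=
    Finset.prod_pos fun i _ => by positivity
  obtain ⟨m, rfl⟩ := Nat.exists_eq_add_of_le' (by omega : 2 ≤ n)
  have hmain := pow_mul_pow_le_of_counts hα hβ hpα hpβ hlt hcount
  rw [stairP, hset, finsum_mem_singleton, stairWt]
  have he : (((m + 2 : ℕ) : ℝ) + 1 / α + 1 / β - 2) * (((m + 2 : ℕ) : ℝ) + 1 / α + 1 / β - 1) =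
      (1 / α + 1 / β + m) * (1 / α + 1 / β + (m + 1)) := by
    push_cast
    ring
  rw [he, div_le_div_iff₀ (hpos.trans_le hZ) (by positivity)]
  linarith
end

section
/- For every integer r ≥ 1 there exists a constant C > 0 such that for all n ≥ 3, all α, β > 0 with a = 1/α and b = 1/β, and all 1 ≤ j_1 < ⋯ < j_r ≤ n−2 satisfying j_{l+1} ≥ j_l + 3 for all l = 1, …, r−1, the probability under ℙ_{n,α,β} that, for every l = 1, …, r, the box (n−j_l−1, j_l) contains α differs from ∏_{l=1}^r (b + j_l − 2l + 1) / ((n+a+b−2l+1)(n+a+b−2l)) by at most C/(n+a+b)^{r+1} in absolute value. -/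
open scoped BigOperators

open StairSymb

/-- All columns of height `n` in which every entry above an `alpha` is empty. -/
noncomputable def stairCols : ℕ → Finset (ℕ → StairSymb)
  | 0 => {fun _ => empty}
  | n + 1 => open Classical in
      ({Function.update (fun _ => empty) (n + 1) alpha} ∪
        (stairCols n).image (fun c => Function.update c (n + 1) beta)) ∪ stairCols n

theorem mem_stairCols (n : ℕ) (c : ℕ → StairSymb) :
    c ∈ stairCols n ↔ (∀ i, ¬(1 ≤ i ∧ i ≤ n) → c i = empty) ∧
      (∀ i i', 1 ≤ i → i < i' → i' ≤ n → c i' = alpha → c i = empty) := by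
  induction n generalizing c with
  | zero =>
    simp only [stairCols, Finset.mem_singleton]
    constructor
    · rintro rfl; simp
    · rintro ⟨h, -⟩
      funext i
      exact h i (by omega)
  | succ n ih =>
    simp only [stairCols, Finset.mem_union, Finset.mem_singleton, Finset.mem_image]
    constructor
    · rintro ((rfl | ⟨d, hd, rfl⟩) | hc)
      · constructor
        · intro i hi
          rw [Function.update_of_ne (by omega)]
        · intro i i' h1 h2 h3 _
          rw [Function.update_of_ne (by omega)]
      · rw [ih] at hd
        constructor
        · intro i hi
          rw [Function.update_of_ne (by omega)]
          exact hd.1 i (by omega)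
        · intro i i' h1 h2 h3 h4
          rw [Function.update_of_ne (by omega)]
          by_cases hi : i' = n + 1
          · subst hi
            simp at h4
          · rw [Function.update_of_ne hi] at h4
            exact hd.2 i i' h1 h2 (by omega) h4
      · rw [ih] at hc
        refine ⟨fun i hi => hc.1 i (by omega), fun i i' h1 h2 h3 h4 => ?_⟩
        by_cases hi : i' = n + 1
        · have := hc.1 i' (by omega)
          rw [this] at h4
          cases h4
        · exact hc.2 i i' h1 h2 (by omega) h4
    · rintro ⟨h1, h2⟩
      cases hs : c (n + 1) with
      | empty =>
        right
        rw [ih]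
        refine ⟨fun i hi => ?_, fun i i' ha hb hc => h2 i i' ha hb (by omega)⟩
        by_cases hi' : i = n + 1
        · rw [hi', hs]
        · exact h1 i (by omega)
      | alpha =>
        left; left
        funext i
        by_cases hi' : i = n + 1
        · subst hi'; simp [hs]
        · rw [Function.update_of_ne hi']
          by_cases hi : 1 ≤ i ∧ i ≤ n
          · exact h2 i (n + 1) hi.1 (by omega) le_rfl hs
          · exact h1 i (by omega)
      | beta =>
        left; right
        refine ⟨Function.update c (n + 1) empty, ?_, ?_⟩
        · rw [ih]
          refine ⟨fun i hi => ?_, fun i i' ha hb hc hd => ?_⟩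
          · by_cases hi' : i = n + 1
            · subst hi'; simp
            · rw [Function.update_of_ne hi']
              exact h1 i (by omega)
          · rw [Function.update_of_ne (by omega)] at hd ⊢
            exact h2 i i' ha hb (by omega) hd
        · rw [Function.update_idem, ← hs, Function.update_eq_self]

/-- The sum over all columns of height `n` of the product of the entry weights `φ`. -/
noncomputable def colTot (φ : ℕ → StairSymb → ℝ) : ℕ → ℝ
  | 0 => 1
  | n + 1 => φ (n + 1) alpha * ∏ i ∈ Finset.range n, φ (i + 1) empty +
      (φ (n + 1) beta + φ (n + 1) empty) * colTot φ n

theorem sum_stairCols (φ : ℕ → StairSymb → ℝ) (n : ℕ) :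
    ∑ c ∈ stairCols n, ∏ i ∈ Finset.range n, φ (i + 1) (c (i + 1)) = colTot φ n := by
  classical
  induction n with
  | zero => simp [stairCols, colTot]
  | succ n ih =>
    have hz : ∀ c ∈ stairCols n, c (n + 1) = empty := fun c hc =>
      ((mem_stairCols n c).1 hc).1 _ (by omega)
    rw [stairCols, Finset.sum_union, Finset.sum_union, Finset.sum_singleton, Finset.sum_image]
    · have e1 : ∀ (c : ℕ → StairSymb) (s : StairSymb),
          ∏ i ∈ Finset.range (n + 1), φ (i + 1) (Function.update c (n + 1) s (i + 1)) =
          (∏ i ∈ Finset.range n, φ (i + 1) (c (i + 1))) * φ (n + 1) s := by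
        intro c s
        rw [Finset.prod_range_succ, Function.update_self]
        congr 1
        refine Finset.prod_congr rfl fun i hi => ?_
        rw [Finset.mem_range] at hi
        rw [Function.update_of_ne (by omega)]
      have e2 : ∀ c ∈ stairCols n, ∏ i ∈ Finset.range (n + 1), φ (i + 1) (c (i + 1)) =
          (∏ i ∈ Finset.range n, φ (i + 1) (c (i + 1))) * φ (n + 1) empty := by
        intro c hc
        rw [Finset.prod_range_succ, hz c hc]
      rw [Finset.sum_congr rfl e2]
      simp only [e1]
      rw [← Finset.sum_mul, ← Finset.sum_mul, ih, colTot]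
      ring
    · intro c hc d hd h
      have hc' := hz c hc
      have hd' := hz d hd
      have := congrArg (fun f => Function.update f (n + 1) empty) h
      simp only [Function.update_idem] at this
      rw [← hc', Function.update_eq_self, hc', ← hd', Function.update_eq_self] at this
      exact this
    · rw [Finset.disjoint_left]
      intro c hc hd
      simp only [Finset.mem_singleton, Finset.mem_image] at hc hd
      obtain ⟨d, -, hd⟩ := hd
      have := congrFun (hd.trans hc) (n + 1)
      simp at this
    · rw [Finset.disjoint_left]
      intro c hc hd
      have h0 := hz c hd
      simp only [Finset.mem_union, Finset.mem_singleton, Finset.mem_image] at hc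
      rcases hc with rfl | ⟨d, -, rfl⟩ <;> simp at h0

/-- Put the column `c` to the left of the tableau `S`. -/
def stairCons (c : ℕ → StairSymb) (S : ℕ → ℕ → StairSymb) : ℕ → ℕ → StairSymb :=
  fun i j => match j with
    | 0 => empty
    | 1 => c i
    | j + 2 => S i (j + 1)

/-- Row `i` of `S` contains no `beta`. -/
def RowFree (S : ℕ → ℕ → StairSymb) (i : ℕ) : Prop := ∀ j, S i j ≠ beta

/-- The column `c` may be put to the left of the size `n` tableau `S`. -/
def ColFits (n : ℕ) (c : ℕ → StairSymb) (S : ℕ → ℕ → StairSymb) : Prop :=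
  c (n + 1) ≠ empty ∧ ∀ i, c i ≠ empty → RowFree S i

/-- The finite set of staircase tableaux of size `n`. -/
noncomputable def stairTabs : ℕ → Finset (ℕ → ℕ → StairSymb)
  | 0 => {fun _ _ => empty}
  | n + 1 => open Classical in
      ((stairTabs n ×ˢ stairCols (n + 1)).filter (fun p => ColFits n p.2 p.1)).image
        (fun p => stairCons p.2 p.1)

theorem isStaircase_succ_cons {n : ℕ} {c : ℕ → StairSymb} {S : ℕ → ℕ → StairSymb}
    (hS : IsStaircase n S) (hc : c ∈ stairCols (n + 1)) (h : ColFits n c S) :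
    IsStaircase (n + 1) (stairCons c S) := by
  rw [mem_stairCols] at hc
  obtain ⟨s1, s2, s3, s4⟩ := hS
  refine ⟨?_, ?_, ?_, ?_⟩
  · intro i j hij
    match j with
    | 0 => rfl
    | 1 => exact hc.1 i (by omega)
    | j + 2 => exact s1 i (j + 1) (by omega)
  · intro i i' j h1 h2 h3 h4
    match j with
    | 0 => omega
    | 1 => exact hc.2 i i' h1 h2 (by omega)
    | j + 2 => exact s2 i i' (j + 1) h1 h2 (by omega) (by omega)
  · intro i j j' h1 h2 h3 h4
    match j, j' with
    | 0, _ => omega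
    | 1, 0 => omega
    | 1, 1 => omega
    | 1, j' + 2 =>
      intro hb
      by_contra hne
      exact h.2 i hne (j' + 1) hb
    | j + 2, 0 => omega
    | j + 2, 1 => omega
    | j + 2, j' + 2 => exact s3 i (j + 1) (j' + 1) h1 (by omega) (by omega) (by omega)
  · intro i j h1 h2 h3
    match j with
    | 0 => omega
    | 1 =>
      have : i = n + 1 := by omega
      subst this
      exact h.1
    | j + 2 => exact s4 i (j + 1) h1 (by omega) (by omega)

theorem mem_stairTabs (n : ℕ) (S : ℕ → ℕ → StairSymb) :
    S ∈ stairTabs n ↔ IsStaircase n S := by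
  induction n generalizing S with
  | zero =>
    simp only [stairTabs, Finset.mem_singleton]
    constructor
    · rintro rfl
      refine ⟨by simp, by simp, by simp, ?_⟩
      intro i j h1 h2 h3
      omega
    · intro h
      funext i j
      exact h.1 i j (by omega)
  | succ n ih =>
    simp only [stairTabs, Finset.mem_image, Finset.mem_filter, Finset.mem_product, Prod.exists]
    constructor
    · rintro ⟨S', c, ⟨⟨hS, hc⟩, hf⟩, rfl⟩
      exact isStaircase_succ_cons ((ih S').1 hS) hc hf
    · rintro ⟨s1, s2, s3, s4⟩
      refine ⟨fun i j => if j = 0 then empty else S i (j + 1), fun i => S i 1, ⟨⟨?_, ?_⟩, ?_⟩, ?_⟩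
      · rw [ih]
        refine ⟨?_, ?_, ?_, ?_⟩
        · intro i j h
          by_cases hj : j = 0
          · simp [hj]
          · simp only [hj, if_false]
            exact s1 _ _ (by omega)
        · intro i i' j h1 h2 h3 h4
          simp only [show j ≠ 0 by omega, if_false]
          exact s2 i i' (j + 1) h1 h2 (by omega) (by omega)
        · intro i j j' h1 h2 h3 h4
          simp only [show j ≠ 0 by omega, show j' ≠ 0 by omega, if_false]
          exact s3 i (j + 1) (j' + 1) h1 (by omega) (by omega) (by omega)
        · intro i j h1 h2 h3
          simp only [show j ≠ 0 by omega, if_false]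
          exact s4 i (j + 1) h1 (by omega) (by omega)
      · rw [mem_stairCols]
        exact ⟨fun i hi => s1 i 1 (by omega),
          fun i i' h1 h2 h3 => s2 i i' 1 h1 h2 le_rfl (by omega)⟩
      · refine ⟨s4 _ _ (by omega) le_rfl (by omega), ?_⟩
        intro i hi j
        by_cases hj : j = 0
        · simp [hj]
        · simp only [hj, if_false]
          intro hb
          have hbox : 1 ≤ i ∧ 1 ≤ j + 1 ∧ i + (j + 1) ≤ n + 1 + 1 := by
            by_contra hcon
            rw [s1 _ _ hcon] at hb
            cases hb
          exact hi (s3 i 1 (j + 1) hbox.1 le_rfl (by omega) hbox.2.2 hb)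
      · funext i j
        match j with
        | 0 => exact (s1 i 0 (by omega)).symm
        | 1 => rfl
        | j + 2 => simp [stairCons]

theorem rowFree_stairCons {n : ℕ} {S : ℕ → ℕ → StairSymb} (hS : S ∈ stairTabs n)
    (c : ℕ → StairSymb) (i : ℕ) :
    RowFree (stairCons c S) i ↔ c i ≠ beta ∧ RowFree S i := by
  rw [mem_stairTabs] at hS
  constructor
  · intro h
    refine ⟨h 1, fun j => ?_⟩
    match j with
    | 0 => rw [hS.1 i 0 (by omega)]; simp
    | j + 1 => exact h (j + 2)
  · rintro ⟨h1, h2⟩ j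
    match j with
    | 0 => simp [stairCons]
    | 1 => exact h1
    | j + 2 => exact h2 (j + 1)

theorem rowFree_of_size_lt {n : ℕ} {S : ℕ → ℕ → StairSymb} (hS : S ∈ stairTabs n)
    {i : ℕ} (hi : n < i) : RowFree S i := by
  rw [mem_stairTabs] at hS
  intro j
  rw [hS.1 i j (by omega)]
  simp

/-- The weight of a single entry. -/
def symbWt (α β : ℝ) : StairSymb → ℝ
  | empty => 1
  | alpha => α
  | beta => β

theorem ncard_stairCons {n : ℕ} {S : ℕ → ℕ → StairSymb} (hS : S ∈ stairTabs n)
    {c : ℕ → StairSymb} (hc : c ∈ stairCols (n + 1)) {s : StairSymb} (hs : s ≠ empty) :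
    Set.ncard {p : ℕ × ℕ | stairCons c S p.1 p.2 = s} =
      Set.ncard {p : ℕ × ℕ | S p.1 p.2 = s} +
        ((Finset.range (n + 1)).filter (fun i => c (i + 1) = s)).card := by
  rw [mem_stairTabs] at hS
  rw [mem_stairCols] at hc
  have hbox : ∀ i j, S i j = s → 1 ≤ i ∧ 1 ≤ j ∧ i + j ≤ n + 1 := by
    intro i j h
    by_contra hcon
    exact hs (h.symm.trans (hS.1 i j hcon))
  have hcol : ∀ i, c i = s → 1 ≤ i ∧ i ≤ n + 1 := by
    intro i h
    by_contra hcon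
    exact hs (h.symm.trans (hc.1 i hcon))
  have hfin : {p : ℕ × ℕ | S p.1 p.2 = s}.Finite := by
    refine ((Finset.range (n + 2)) ×ˢ (Finset.range (n + 2))).finite_toSet.subset ?_
    rintro ⟨i, j⟩ h
    have := hbox i j h
    simp
    omega
  have hdec : {p : ℕ × ℕ | stairCons c S p.1 p.2 = s} =
      (fun p : ℕ × ℕ => (p.1, p.2 + 1)) '' {p : ℕ × ℕ | S p.1 p.2 = s} ∪
      (fun i => (i + 1, 1)) '' (((Finset.range (n + 1)).filter (fun i => c (i + 1) = s) :
        Finset ℕ) : Set ℕ) := by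
    ext ⟨i, j⟩
    simp only [Set.mem_ofPred_eq, Set.mem_union, Set.mem_image, Prod.exists, Prod.mk.injEq,
      Finset.coe_filter, Finset.mem_range]
    match j with
    | 0 =>
      constructor
      · intro h
        exact absurd h.symm hs
      · rintro (⟨x, y, -, -, h⟩ | ⟨x, -, -, h⟩) <;> omega
    | 1 =>
      constructor
      · intro h
        have := hcol i h
        refine Or.inr ⟨i - 1, ⟨by omega, ?_⟩, by omega, rfl⟩
        rw [show i - 1 + 1 = i by omega]
        exact h
      · rintro (⟨x, y, h1, rfl, h⟩ | ⟨x, ⟨-, h1⟩, rfl, -⟩)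
        · have := hbox _ _ h1
          omega
        · exact h1
    | j + 2 =>
      constructor
      · intro h
        exact Or.inl ⟨i, j + 1, h, rfl, rfl⟩
      · rintro (⟨x, y, h1, rfl, h⟩ | ⟨x, -, -, h⟩)
        · have : y = j + 1 := by omega
          subst this
          exact h1
        · omega
  rw [hdec, Set.ncard_union_eq _ (hfin.image _) ((Finset.finite_toSet _).image _),
    Set.ncard_image_of_injective, Set.ncard_image_of_injective, Set.ncard_coe_finset]
  · intro x y h
    simpa using h
  · rintro ⟨x, y⟩ ⟨z, w⟩ h
    simpa using h
  · rw [Set.disjoint_left]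
    rintro ⟨i, j⟩ ⟨⟨x, y⟩, h1, h2⟩ ⟨z, -, h3⟩
    have := hbox _ _ h1
    simp only [Prod.mk.injEq] at h2 h3
    omega

theorem stairWt_stairCons (α β : ℝ) {n : ℕ} {S : ℕ → ℕ → StairSymb} (hS : S ∈ stairTabs n)
    {c : ℕ → StairSymb} (hc : c ∈ stairCols (n + 1)) :
    stairWt α β (stairCons c S) =
      stairWt α β S * ∏ i ∈ Finset.range (n + 1), symbWt α β (c (i + 1)) := by
  have hprod : ∀ s : Finset ℕ, ∏ i ∈ s, symbWt α β (c (i + 1)) =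
      α ^ (s.filter (fun i => c (i + 1) = alpha)).card *
      β ^ (s.filter (fun i => c (i + 1) = beta)).card := by
    intro s
    rw [← Finset.prod_const, ← Finset.prod_const, Finset.prod_filter, Finset.prod_filter,
      ← Finset.prod_mul_distrib]
    refine Finset.prod_congr rfl fun i _ => ?_
    cases c (i + 1) <;> simp [symbWt]
  rw [stairWt, stairWt, ncard_stairCons hS hc (by simp), ncard_stairCons hS hc (by simp), hprod,
    pow_add, pow_add]
  ring

theorem stairWt_empty (α β : ℝ) : stairWt α β (fun _ _ => empty) = 1 := by
  simp [stairWt]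

/-- The weighted sum of `e` over tableaux of size `n`, where each row `i` contributes an
additional factor `u i` or `v i` according to whether it is free of `beta` or not. -/
noncomputable def stairTot (α β : ℝ) (n : ℕ) (e : (ℕ → ℕ → StairSymb) → ℝ) (u v : ℕ → ℝ) : ℝ :=
  open Classical in
  ∑ S ∈ stairTabs n, e S * stairWt α β S *
    ∏ i ∈ Finset.range n, if RowFree S (i + 1) then u (i + 1) else v (i + 1)

/-- The weight of the entry `s` in row `i` of a new column put to the left of the size `n`
tableau `S`. -/
noncomputable def entryWt (α β : ℝ) (n : ℕ) (θ : ℕ → StairSymb → ℝ) (u v : ℕ → ℝ)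
    (S : ℕ → ℕ → StairSymb) (i : ℕ) (s : StairSymb) : ℝ :=
  open Classical in
  match s with
  | empty => if i = n + 1 then 0 else θ i empty * if RowFree S i then u i else v i
  | alpha => if RowFree S i then θ i alpha * α * u i else 0
  | beta => if RowFree S i then θ i beta * β * v i else 0

theorem stairTot_succ (α β : ℝ) (n : ℕ) (e e' : (ℕ → ℕ → StairSymb) → ℝ) (u v : ℕ → ℝ)
    (θ : ℕ → StairSymb → ℝ)
    (he : ∀ S ∈ stairTabs n, ∀ c ∈ stairCols (n + 1), e (stairCons c S) =
      e' S * ∏ i ∈ Finset.range (n + 1), θ (i + 1) (c (i + 1))) :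
    stairTot α β (n + 1) e u v = ∑ S ∈ stairTabs n, e' S * stairWt α β S *
      colTot (entryWt α β n θ u v S) (n + 1) := by
  classical
  rw [stairTot, stairTabs, Finset.sum_image, Finset.sum_filter, Finset.sum_product]
  · refine Finset.sum_congr rfl fun S hS => ?_
    rw [← sum_stairCols, Finset.mul_sum]
    refine Finset.sum_congr rfl fun c hc => ?_
    simp only []
    split_ifs with hfit
    · rw [he S hS c hc, stairWt_stairCons α β hS hc]
      have : ∏ i ∈ Finset.range (n + 1), entryWt α β n θ u v S (i + 1) (c (i + 1)) =
          (∏ i ∈ Finset.range (n + 1), θ (i + 1) (c (i + 1))) *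
          (∏ i ∈ Finset.range (n + 1), symbWt α β (c (i + 1))) *
          ∏ i ∈ Finset.range (n + 1),
            if RowFree (stairCons c S) (i + 1) then u (i + 1) else v (i + 1) := by
        rw [← Finset.prod_mul_distrib, ← Finset.prod_mul_distrib]
        refine Finset.prod_congr rfl fun i hi => ?_
        rw [rowFree_stairCons hS]
        have h2 := hfit.2 (i + 1)
        have h1 : i + 1 = n + 1 → c (i + 1) ≠ empty := fun h => h ▸ hfit.1
        cases hs : c (i + 1) <;> rw [hs] at h1 h2 <;> simp_all [entryWt, symbWt]
      rw [this]
      ring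
    · have : ∏ i ∈ Finset.range (n + 1), entryWt α β n θ u v S (i + 1) (c (i + 1)) = 0 := by
        rw [ColFits, not_and_or] at hfit
        rcases hfit with h | h
        · refine Finset.prod_eq_zero (i := n) (by simp) ?_
          rw [not_not] at h
          simp [h, entryWt]
        · push Not at h
          obtain ⟨i, hi, hf⟩ := h
          have hb : 1 ≤ i ∧ i ≤ n + 1 := by
            by_contra hcon
            exact hi (((mem_stairCols _ _).1 hc).1 i hcon)
          refine Finset.prod_eq_zero (i := i - 1) (by simp; omega) ?_
          rw [show i - 1 + 1 = i by omega]
          cases hs : c i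
          · exact absurd hs hi
          · simp [entryWt, hf]
          · simp [entryWt, hf]
      rw [this, mul_zero]
  · rintro ⟨S, c⟩ h ⟨S', c'⟩ h' heq
    simp only [Finset.coe_filter, Finset.mem_product, Set.mem_ofPred_eq] at h h'
    have hS := (mem_stairTabs n S).1 h.1.1
    have hS' := (mem_stairTabs n S').1 h'.1.1
    simp only at heq
    rw [Prod.mk.injEq]
    constructor
    · funext i j
      match j with
      | 0 => rw [hS.1 i 0 (by omega), hS'.1 i 0 (by omega)]
      | j + 1 => exact congrFun (congrFun heq i) (j + 2)
    · funext i
      exact congrFun (congrFun heq i) 1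

theorem beta_mul_colTot (α β x : ℝ) (F : ℕ → Prop) [DecidablePred F]
    (φ : ℕ → StairSymb → ℝ) (n : ℕ)
    (h0 : ∀ i < n, φ (i + 1) empty = if F (i + 1) then x else 1)
    (h1 : ∀ i < n, φ (i + 1) alpha = if F (i + 1) then α * x else 0)
    (h2 : ∀ i < n, φ (i + 1) beta = if F (i + 1) then β else 0) :
    β * colTot φ n = (α * x + β) * (∏ i ∈ Finset.range n, if F (i + 1) then x + β else 1) -
      α * x * ∏ i ∈ Finset.range n, if F (i + 1) then x else 1 := by
  induction n with
  | zero => simp [colTot]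
  | succ n ih =>
    have ih' := ih (fun i hi => h0 i (by omega)) (fun i hi => h1 i (by omega))
      (fun i hi => h2 i (by omega))
    have hp : ∏ i ∈ Finset.range n, φ (i + 1) empty =
        ∏ i ∈ Finset.range n, if F (i + 1) then x else 1 :=
      Finset.prod_congr rfl fun i hi => h0 i (by rw [Finset.mem_range] at hi; omega)
    rw [colTot, hp, h0 n (by omega), h1 n (by omega), h2 n (by omega), Finset.prod_range_succ,
      Finset.prod_range_succ]
    by_cases hF : F (n + 1)
    · simp only [hF, if_true]
      linear_combination (β + x) * ih'
    · simp only [hF, if_false]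
      linear_combination ih'

/-- The weighted sum of `e` over tableaux of size `n`, where rows without `beta` are marked
by a factor `x`. -/
noncomputable def freeTot (α β : ℝ) (n : ℕ) (e : (ℕ → ℕ → StairSymb) → ℝ) (x : ℝ) : ℝ :=
  stairTot α β n e (fun _ => x) (fun _ => 1)

theorem freeTot_succ (α β : ℝ) (n : ℕ) (e e' : (ℕ → ℕ → StairSymb) → ℝ) (x : ℝ)
    (he : ∀ S ∈ stairTabs n, ∀ c ∈ stairCols (n + 1), e (stairCons c S) = e' S) :
    freeTot α β (n + 1) e x = (α * x + β) * freeTot α β n e' (x + β) := by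
  classical
  rw [freeTot, stairTot_succ α β n e e' _ _ (fun _ _ => 1)
    (fun S hS c hc => by rw [he S hS c hc]; simp), freeTot, stairTot, Finset.mul_sum]
  refine Finset.sum_congr rfl fun S hS => ?_
  have hf : RowFree S (n + 1) := rowFree_of_size_lt hS (by omega)
  have hp : ∏ i ∈ Finset.range n,
      entryWt α β n (fun _ _ => 1) (fun _ => x) (fun _ => 1) S (i + 1) empty =
        ∏ i ∈ Finset.range n, if RowFree S (i + 1) then x else 1 := by
    refine Finset.prod_congr rfl fun i hi => ?_
    rw [Finset.mem_range] at hi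
    simp [entryWt, hi.ne]
  have hK := beta_mul_colTot α β x (RowFree S)
    (entryWt α β n (fun _ _ => 1) (fun _ => x) (fun _ => 1) S) n
    (fun i hi => by simp [entryWt, hi.ne]) (fun i hi => by simp [entryWt])
    (fun i hi => by simp [entryWt])
  have f1 : entryWt α β n (fun _ _ => 1) (fun _ => x) (fun _ => 1) S (n + 1) alpha = α * x := by
    simp [entryWt, hf]
  have f2 : entryWt α β n (fun _ _ => 1) (fun _ => x) (fun _ => 1) S (n + 1) beta = β := by
    simp [entryWt, hf]
  have f3 : entryWt α β n (fun _ _ => 1) (fun _ => x) (fun _ => 1) S (n + 1) empty = 0 := by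
    simp [entryWt]
  rw [colTot, hp, f1, f2, f3]
  linear_combination (e' S * stairWt α β S) * hK

theorem freeTot_alpha_third (α β : ℝ) (n : ℕ) (e e' : (ℕ → ℕ → StairSymb) → ℝ) (x : ℝ)
    (he : ∀ S ∈ stairTabs (n + 2), ∀ c ∈ stairCols (n + 3), e (stairCons c S) =
      e' S * if c (n + 1) = alpha then 1 else 0) :
    freeTot α β (n + 3) e x = β * α * x * stairTot α β (n + 2) e'
      (fun i => if i = n + 1 then 1 else if i = n + 2 then x + β else x)
      (fun i => if i = n + 1 then 0 else 1) := by
  classical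
  set θ : ℕ → StairSymb → ℝ := fun i s => if i = n + 1 ∧ s ≠ alpha then 0 else 1 with hθ
  have hθp : ∀ c : ℕ → StairSymb, ∏ i ∈ Finset.range (n + 3), θ (i + 1) (c (i + 1)) =
      if c (n + 1) = alpha then 1 else 0 := by
    intro c
    rw [Finset.prod_eq_single n]
    · by_cases h : c (n + 1) = alpha <;> simp [hθ, h]
    · intro i _ hi
      simp [hθ, hi]
    · simp
  rw [freeTot, stairTot_succ α β (n + 2) e e' _ _ θ
    (fun S hS c hc => by rw [he S hS c hc, hθp]), stairTot, Finset.mul_sum]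
  refine Finset.sum_congr rfl fun S hS => ?_
  have hf : RowFree S (n + 3) := rowFree_of_size_lt hS (by omega)
  have hp : ∏ i ∈ Finset.range n, entryWt α β (n + 2) θ (fun _ => x) (fun _ => 1) S (i + 1) empty =
      ∏ i ∈ Finset.range n, if RowFree S (i + 1) then x else 1 := by
    refine Finset.prod_congr rfl fun i hi => ?_
    rw [Finset.mem_range] at hi
    simp [entryWt, hθ, hi.ne, show i ≠ n + 2 by omega]
  have hq : (∏ i ∈ Finset.range n, if RowFree S (i + 1) then
      (if i + 1 = n + 1 then (1 : ℝ) else if i + 1 = n + 2 then x + β else x) else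
      (if i + 1 = n + 1 then 0 else 1)) =
      ∏ i ∈ Finset.range n, if RowFree S (i + 1) then x else 1 := by
    refine Finset.prod_congr rfl fun i hi => ?_
    rw [Finset.mem_range] at hi
    simp [hi.ne, show i ≠ n + 1 by omega]
  rw [colTot, colTot, colTot]
  simp only [Finset.prod_range_succ]
  rw [hp, hq]
  by_cases h1 : RowFree S (n + 1) <;> by_cases h2 : RowFree S (n + 2) <;>
    simp [entryWt, hθ, hf, h1, h2] <;> ring

theorem stairTot_alpha_second (α β : ℝ) (n : ℕ) (e e' : (ℕ → ℕ → StairSymb) → ℝ) (x : ℝ)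
    (he : ∀ S ∈ stairTabs (n + 1), ∀ c ∈ stairCols (n + 2), e (stairCons c S) = e' S) :
    stairTot α β (n + 2) e
      (fun i => if i = n + 1 then 1 else if i = n + 2 then x + β else x)
      (fun i => if i = n + 1 then 0 else 1) =
    2 * α * β * stairTot α β (n + 1) e'
      (fun i => if i = n + 1 then 1 else x) (fun i => if i = n + 1 then 0 else 1) +
    (α * x + β) * stairTot α β (n + 1) e'
      (fun i => if i = n + 1 then 1 else x + β) (fun i => if i = n + 1 then 0 else 1) := by
  classical
  rw [stairTot_succ α β (n + 1) e e' _ _ (fun _ _ => 1)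
    (fun S hS c hc => by rw [he S hS c hc]; simp), stairTot, stairTot, Finset.mul_sum,
    Finset.mul_sum, ← Finset.sum_add_distrib]
  refine Finset.sum_congr rfl fun S hS => ?_
  have hf : RowFree S (n + 2) := rowFree_of_size_lt hS (by omega)
  set φ := entryWt α β (n + 1) (fun _ _ => 1)
    (fun i => if i = n + 1 then 1 else if i = n + 2 then x + β else x)
    (fun i => if i = n + 1 then 0 else 1) S with hφ
  have h0 : ∀ i < n, φ (i + 1) empty = if RowFree S (i + 1) then x else 1 := fun i hi => by
    simp [hφ, entryWt, hi.ne, show i ≠ n + 1 by omega]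
  have hK := beta_mul_colTot α β x (RowFree S) φ n h0
    (fun i hi => by simp [hφ, entryWt, hi.ne, show i ≠ n + 1 by omega])
    (fun i hi => by simp [hφ, entryWt, hi.ne])
  have hp : ∏ i ∈ Finset.range n, φ (i + 1) empty =
      ∏ i ∈ Finset.range n, if RowFree S (i + 1) then x else 1 :=
    Finset.prod_congr rfl fun i hi => h0 i (Finset.mem_range.1 hi)
  have hq : ∀ z : ℝ, (∏ i ∈ Finset.range n, if RowFree S (i + 1) then
      (if i + 1 = n + 1 then (1 : ℝ) else z) else (if i + 1 = n + 1 then 0 else 1)) =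
      ∏ i ∈ Finset.range n, if RowFree S (i + 1) then z else 1 := by
    intro z
    refine Finset.prod_congr rfl fun i hi => ?_
    rw [Finset.mem_range] at hi
    simp [hi.ne]
  rw [colTot, colTot]
  simp only [Finset.prod_range_succ]
  rw [hp, hq, hq]
  by_cases h1 : RowFree S (n + 1)
  · have f1 : φ (n + 2) alpha = α * (x + β) := by simp [hφ, entryWt, hf]
    have f2 : φ (n + 2) beta = β := by simp [hφ, entryWt, hf]
    have f3 : φ (n + 2) empty = 0 := by simp [hφ, entryWt]
    have f4 : φ (n + 1) alpha = α := by simp [hφ, entryWt, h1]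
    have f5 : φ (n + 1) beta = 0 := by simp [hφ, entryWt]
    have f6 : φ (n + 1) empty = 1 := by simp [hφ, entryWt, h1]
    simp only [show n + 1 + 1 = n + 2 from rfl, f1, f2, f3, f4, f5, f6, h1, if_true]
    linear_combination (e' S * stairWt α β S) * hK
  · simp [hφ, entryWt, h1]

theorem stairTot_alpha_first (α β : ℝ) (n : ℕ) (e e' : (ℕ → ℕ → StairSymb) → ℝ) (x : ℝ)
    (he : ∀ S ∈ stairTabs n, ∀ c ∈ stairCols (n + 1), e (stairCons c S) = e' S) :
    stairTot α β (n + 1) e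
      (fun i => if i = n + 1 then 1 else x) (fun i => if i = n + 1 then 0 else 1) =
    α * freeTot α β n e' x := by
  classical
  rw [stairTot_succ α β n e e' _ _ (fun _ _ => 1)
    (fun S hS c hc => by rw [he S hS c hc]; simp), freeTot, stairTot, Finset.mul_sum]
  refine Finset.sum_congr rfl fun S hS => ?_
  have hf : RowFree S (n + 1) := rowFree_of_size_lt hS (by omega)
  rw [colTot]
  have hp : (∏ i ∈ Finset.range n, entryWt α β n (fun _ _ => 1)
      (fun i => if i = n + 1 then 1 else x) (fun i => if i = n + 1 then 0 else 1) S
      (i + 1) empty) = ∏ i ∈ Finset.range n, if RowFree S (i + 1) then x else 1 := by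
    refine Finset.prod_congr rfl fun i hi => ?_
    rw [Finset.mem_range] at hi
    simp [entryWt, hi.ne]
  rw [hp]
  simp [entryWt, hf]
  ring

theorem freeTot_add_three (α β : ℝ) (n : ℕ) (e e' : (ℕ → ℕ → StairSymb) → ℝ) (x : ℝ)
    (he : ∀ S ∈ stairTabs n, ∀ c₁ c₂ c₃ : ℕ → StairSymb,
      e (stairCons c₃ (stairCons c₂ (stairCons c₁ S))) =
        e' S * if c₃ (n + 1) = alpha then 1 else 0) :
    freeTot α β (n + 3) e x = α ^ 2 * β * x *
      (2 * α * β * freeTot α β n e' x + (α * x + β) * freeTot α β n e' (x + β)) := by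
  classical
  have htail : ∀ m, ∀ S ∈ stairTabs m, (fun i j => if j = 0 then empty else S i j) = S := by
    intro m S hS
    rw [mem_stairTabs] at hS
    funext i j
    by_cases hj : j = 0
    · rw [if_pos hj, hj, hS.1 i 0 (by omega)]
    · rw [if_neg hj]
  set t : (ℕ → ℕ → StairSymb) → ℕ → ℕ → StairSymb :=
    fun S i j => if j = 0 then empty else S i (j + 1) with ht
  have htc : ∀ m, ∀ S ∈ stairTabs m, ∀ c, t (stairCons c S) = S := by
    intro m S hS c
    conv_rhs => rw [← htail m S hS]
    funext i j
    match j with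
    | 0 => simp [ht]
    | j + 1 => simp [ht, stairCons]
  have hsplit : ∀ m, ∀ S ∈ stairTabs (m + 1), ∃ S' ∈ stairTabs m, ∃ c, S = stairCons c S' := by
    intro m S hS
    simp only [stairTabs, Finset.mem_image, Finset.mem_filter, Finset.mem_product,
      Prod.exists] at hS
    obtain ⟨S', c, ⟨⟨h1, -⟩, -⟩, rfl⟩ := hS
    exact ⟨S', h1, c, rfl⟩
  rw [freeTot_alpha_third α β n e (fun S => e' (t (t S))) x,
    stairTot_alpha_second α β n _ (fun S => e' (t S)) x,
    stairTot_alpha_first α β n _ e' x, stairTot_alpha_first α β n _ e' (x + β)]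
  · ring
  · intro S hS c _
    simp only [htc n S hS]
  · intro S hS c _
    simp only [htc n S hS]
  · intro S hS c _
    simp only [htc (n + 1) S hS]
  · intro S hS c _
    obtain ⟨S', hS', c', rfl⟩ := hsplit _ S hS
    obtain ⟨S'', hS'', c'', rfl⟩ := hsplit _ S' hS'
    rw [he S'' hS'', htc _ _ hS', htc _ _ hS'']

/-- The indicator that the boxes of the third diagonal in the columns `j l` contain `alpha`. -/
noncomputable def thirdDiagInd (n : ℕ) {r : ℕ} (j : Fin r → ℕ) (S : ℕ → ℕ → StairSymb) : ℝ :=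
  open Classical in if ∀ l, S (n - j l - 1) (j l) = alpha then 1 else 0

/-- The rising factorial `s (s + 1) ⋯ (s + n - 1)`. -/
noncomputable def risingFact (s : ℝ) (n : ℕ) : ℝ := ∏ k ∈ Finset.range n, (s + k)

theorem risingFact_succ (s : ℝ) (n : ℕ) : risingFact s (n + 1) = risingFact s n * (s + n) := by
  rw [risingFact, Finset.prod_range_succ, risingFact]

theorem risingFact_succ_left (s : ℝ) (n : ℕ) :
    risingFact s (n + 1) = s * risingFact (s + 1) n := by
  rw [risingFact, Finset.prod_range_succ', risingFact, mul_comm]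
  congr 1
  · simp
  · refine Finset.prod_congr rfl fun k _ => ?_
    push_cast
    ring

theorem risingFact_pos {s : ℝ} (hs : 0 < s) (n : ℕ) : 0 < risingFact s n :=
  Finset.prod_pos fun k _ => by positivity

theorem freeTot_thirdDiagInd_succ (α β : ℝ) (n : ℕ) {r : ℕ} (j : Fin r → ℕ) (x : ℝ)
    (hj : ∀ l, 2 ≤ j l) :
    freeTot α β (n + 1) (thirdDiagInd (n + 1) j) x =
      (α * x + β) * freeTot α β n (thirdDiagInd n (fun l => j l - 1)) (x + β) := by
  refine freeTot_succ α β n _ _ x fun S _ c _ => ?_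
  have : ∀ l, stairCons c S (n + 1 - j l - 1) (j l) = S (n - (j l - 1) - 1) (j l - 1) := by
    intro l
    obtain ⟨k, hk⟩ := Nat.exists_eq_add_of_le' (hj l)
    rw [hk, show n + 1 - (k + 2) - 1 = n - (k + 2 - 1) - 1 by omega]
    rfl
  simp only [thirdDiagInd, this]

theorem freeTot_thirdDiagInd_add_three (α β : ℝ) (n : ℕ) {r : ℕ} (j : Fin (r + 1) → ℕ) (x : ℝ)
    (h0 : j 0 = 1) (hj : ∀ l : Fin r, 4 ≤ j l.succ) :
    freeTot α β (n + 3) (thirdDiagInd (n + 3) j) x = α ^ 2 * β * x *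
      (2 * α * β * freeTot α β n (thirdDiagInd n (fun l : Fin r => j l.succ - 3)) x +
        (α * x + β) * freeTot α β n (thirdDiagInd n (fun l : Fin r => j l.succ - 3)) (x + β)) := by
  classical
  refine freeTot_add_three α β n _ _ x fun S _ c₁ c₂ c₃ => ?_
  have : ∀ l : Fin r, stairCons c₃ (stairCons c₂ (stairCons c₁ S)) (n + 3 - j l.succ - 1)
      (j l.succ) = S (n - (j l.succ - 3) - 1) (j l.succ - 3) := by
    intro l
    obtain ⟨k, hk⟩ := Nat.exists_eq_add_of_le' (hj l)
    rw [hk, show n + 3 - (k + 4) - 1 = n - (k + 4 - 3) - 1 by omega]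
    rfl
  have h1 : stairCons c₃ (stairCons c₂ (stairCons c₁ S)) (n + 3 - 1 - 1) 1 = c₃ (n + 1) := rfl
  simp only [thirdDiagInd, Fin.forall_fin_succ, this, h0, h1]
  by_cases hc : c₃ (n + 1) = alpha <;> simp [hc]

/-- The normalised weight of the tableaux having `alpha` in the columns `j l` of the third
diagonal, as a function of the row parameter `y`; at `y = 1 / β` it is the probability of
that event. -/
noncomputable def thirdDiagQ (α β : ℝ) (n : ℕ) {r : ℕ} (j : Fin r → ℕ) (y : ℝ) : ℝ :=
  freeTot α β n (thirdDiagInd n j) (β * y) / ((α * β) ^ n * risingFact (y + 1 / α) n)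

theorem thirdDiagQ_succ {α β : ℝ} (hα : 0 < α) (hβ : 0 < β) (n : ℕ) {r : ℕ} (j : Fin r → ℕ)
    {y : ℝ} (hy : 0 < y) (hj : ∀ l, 2 ≤ j l) :
    thirdDiagQ α β (n + 1) j y = thirdDiagQ α β n (fun l => j l - 1) (y + 1) := by
  rw [thirdDiagQ, thirdDiagQ, freeTot_thirdDiagInd_succ α β n j _ hj, risingFact_succ_left,
    show y + 1 + 1 / α = y + 1 / α + 1 by ring, show β * y + β = β * (y + 1) by ring]
  have h1 : 0 < y + 1 / α := by positivity
  have h2 := risingFact_pos (show 0 < y + 1 / α + 1 by positivity) n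
  rw [show α * (β * y) + β = α * β * (y + 1 / α) by field_simp]
  have h3 : 0 < α * β := by positivity
  rw [pow_succ, show (α * β) ^ n * (α * β) * ((y + 1 / α) * risingFact (y + 1 / α + 1) n) =
    (α * β * (y + 1 / α)) * ((α * β) ^ n * risingFact (y + 1 / α + 1) n) by ring]
  exact mul_div_mul_left _ _ (by positivity)

theorem thirdDiagQ_nil {α β : ℝ} (hα : 0 < α) (hβ : 0 < β) (n : ℕ) (j : Fin 0 → ℕ)
    {y : ℝ} (hy : 0 < y) : thirdDiagQ α β n j y = 1 := by
  induction n generalizing y with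
  | zero =>
    simp [thirdDiagQ, freeTot, stairTot, stairTabs, thirdDiagInd, risingFact, stairWt_empty]
  | succ n ih =>
    rw [thirdDiagQ_succ hα hβ n j hy (fun l => l.elim0), Subsingleton.elim (fun l => j l - 1) j]
    exact ih (by positivity)

theorem thirdDiagQ_add_three {α β : ℝ} (hα : 0 < α) (hβ : 0 < β) (n : ℕ) {r : ℕ}
    (j : Fin (r + 1) → ℕ) {y : ℝ} (hy : 0 < y) (h0 : j 0 = 1) (hj : ∀ l : Fin r, 4 ≤ j l.succ) :
    thirdDiagQ α β (n + 3) j y =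
      2 * y * thirdDiagQ α β n (fun l : Fin r => j l.succ - 3) y /
        ((y + 1 / α + n) * (y + 1 / α + n + 1) * (y + 1 / α + n + 2)) +
      y * thirdDiagQ α β n (fun l : Fin r => j l.succ - 3) (y + 1) /
        ((y + 1 / α + n + 1) * (y + 1 / α + n + 2)) := by
  rw [thirdDiagQ, thirdDiagQ, thirdDiagQ, freeTot_thirdDiagInd_add_three α β n j _ h0 hj,
    show y + 1 + 1 / α = y + 1 / α + 1 by ring, show β * y + β = β * (y + 1) by ring,
    show α * (β * y) + β = α * β * (y + 1 / α) by field_simp]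
  have hs : 0 < y + 1 / α := by positivity
  set s := y + 1 / α
  have h1 := risingFact_pos hs n
  have h2 := risingFact_pos (show 0 < s + 1 by positivity) n
  have h3 : risingFact (s + 1) n = risingFact s n * (s + n) / s := by
    rw [← risingFact_succ, risingFact_succ_left]
    field_simp
  rw [h3, risingFact_succ, risingFact_succ, risingFact_succ]
  push_cast
  set R := risingFact s n
  have h4 : 0 < s + n := by positivity
  have h5 : 0 < s + n + 1 := by positivity
  have h6 : 0 < s + n + 2 := by positivity
  rw [← add_assoc s, ← add_assoc s, pow_add]
  field_simp

theorem stairTabs_sum_eq (n : ℕ) (α β : ℝ) (E : (ℕ → ℕ → StairSymb) → Prop) [DecidablePred E] :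
    ∑ᶠ S ∈ {S : ℕ → ℕ → StairSymb | IsStaircase n S ∧ E S}, stairWt α β S =
      ∑ S ∈ stairTabs n, (if E S then 1 else 0) * stairWt α β S := by
  have : {S : ℕ → ℕ → StairSymb | IsStaircase n S ∧ E S} = ((stairTabs n).filter E : Set _) := by
    ext S
    simp [mem_stairTabs]
  rw [this, finsum_mem_coe_finset, Finset.sum_filter]
  exact Finset.sum_congr rfl fun S _ => by split_ifs <;> simp

theorem freeTot_one (α β : ℝ) (n : ℕ) (e : (ℕ → ℕ → StairSymb) → ℝ) :
    freeTot α β n e 1 = ∑ S ∈ stairTabs n, e S * stairWt α β S := by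
  simp [freeTot, stairTot]

theorem stairP_thirdDiag {α β : ℝ} (hα : 0 < α) (hβ : 0 < β) (n : ℕ) {r : ℕ} (j : Fin r → ℕ) :
    stairP n α β (fun S => ∀ l, S (n - j l - 1) (j l) = alpha) =
      thirdDiagQ α β n j (1 / β) := by
  classical
  have hb : β * (1 / β) = 1 := by field_simp
  have hs : 0 < 1 / β + 1 / α := by positivity
  have hZ : stairZ n α β = (α * β) ^ n * risingFact (1 / β + 1 / α) n := by
    have h1 := thirdDiagQ_nil hα hβ n (fun l => l.elim0) (show 0 < 1 / β by positivity)
    rw [thirdDiagQ, hb, freeTot_one, div_eq_one_iff_eq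
      (by have := risingFact_pos hs n; positivity)] at h1
    rw [← h1, stairZ]
    have h2 := stairTabs_sum_eq n α β (fun _ => True)
    simp only [and_true, if_true] at h2
    rw [h2]
    exact Finset.sum_congr rfl fun S _ => by simp [thirdDiagInd]
  rw [stairP, stairTabs_sum_eq, hZ, thirdDiagQ, hb, freeTot_one]
  congr 1

/-- The main term of the probability that the columns `j l` of the third diagonal
contain `alpha`. -/
noncomputable def thirdDiagMain (n : ℕ) {r : ℕ} (j : Fin r → ℕ) (a y : ℝ) : ℝ :=
  ∏ l : Fin r, (y + (j l : ℝ) - 2 * ((l : ℕ) + 1 : ℝ) + 1) /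
    (((n : ℝ) + a + y - 2 * ((l : ℕ) + 1 : ℝ) + 1) * ((n : ℝ) + a + y - 2 * ((l : ℕ) + 1 : ℝ)))

theorem thirdDiagMain_succ (n : ℕ) {r : ℕ} (j : Fin r → ℕ) (a y : ℝ) (hj : ∀ l, 1 ≤ j l) :
    thirdDiagMain (n + 1) j a y = thirdDiagMain n (fun l => j l - 1) a (y + 1) := by
  refine Finset.prod_congr rfl fun l _ => ?_
  rw [Nat.cast_sub (hj l)]
  push_cast
  congr 1
  · ring
  · ring

theorem thirdDiagMain_add_three (n : ℕ) {r : ℕ} (j : Fin (r + 1) → ℕ) (a y : ℝ)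
    (h0 : j 0 = 1) (hj : ∀ l : Fin r, 3 ≤ j l.succ) :
    thirdDiagMain (n + 3) j a y = y / ((y + a + n + 1) * (y + a + n + 2)) *
      thirdDiagMain n (fun l : Fin r => j l.succ - 3) a (y + 1) := by
  rw [thirdDiagMain, Fin.prod_univ_succ, h0, thirdDiagMain]
  congr 1
  · push_cast [Fin.val_zero]
    congr 1
    · ring
    · ring
  · refine Finset.prod_congr rfl fun l _ => ?_
    rw [Nat.cast_sub (hj l)]
    push_cast [Fin.val_succ]
    congr 1
    · ring
    · ring

theorem div_pow_le_of_le_two_mul {C M N : ℝ} (hC : 0 < C) (hM : 0 < M) (hN : M ≤ 2 * N) (r : ℕ) :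
    C / N ^ r ≤ C * 2 ^ r / M ^ r := by
  have hN0 : 0 < N := by linarith
  rw [div_le_div_iff₀ (by positivity) (by positivity), mul_assoc, ← mul_pow]
  gcongr

theorem thirdDiagQ_approx (r : ℕ) : ∃ C : ℝ, 0 < C ∧ ∀ α β : ℝ, 0 < α → 0 < β →
    ∀ n : ℕ, ∀ j : Fin r → ℕ, ∀ y : ℝ, 0 < y → (∀ l, 1 ≤ j l) → (∀ l, j l + 2 ≤ n) →
      (∀ l l', l < l' → j l + 3 ≤ j l') →
      0 ≤ thirdDiagQ α β n j y ∧
      thirdDiagQ α β n j y ≤ C / (y + 1 / α + n + 3) ^ r ∧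
      |thirdDiagQ α β n j y - thirdDiagMain n j (1 / α) y| ≤
        C / (y + 1 / α + n + 3) ^ (r + 1) := by
  induction r with
  | zero =>
    refine ⟨1, one_pos, fun α β hα hβ n j y hy _ _ _ => ?_⟩
    rw [thirdDiagQ_nil hα hβ n j hy]
    have : 0 < y + 1 / α + n + 3 := by positivity
    simp [thirdDiagMain]
    positivity
  | succ r ih =>
    obtain ⟨C, hC, ih⟩ := ih
    refine ⟨36 * (C * 2 ^ r) + 3 * (C * 2 ^ (r + 1)), by positivity, ?_⟩
    intro α β hα hβ n
    induction n with
    | zero =>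
      intro j y _ _ h2 _
      have := h2 0
      omega
    | succ n ihn =>
      intro j y hy h1 h2 h3
      have hsucc : ∀ l : Fin r, j 0 + 3 ≤ j l.succ := fun l => h3 _ _ (Fin.succ_pos l)
      by_cases h0 : j 0 = 1
      · obtain ⟨m, rfl⟩ : ∃ m, n = m + 2 := ⟨n - 2, by have := h2 0; omega⟩
        have h4 : ∀ l : Fin r, 4 ≤ j l.succ := fun l => by have := hsucc l; omega
        have v1 : ∀ l : Fin r, 1 ≤ j l.succ - 3 := fun l => by have := h4 l; omega
        have v2 : ∀ l : Fin r, j l.succ - 3 + 2 ≤ m := fun l => by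
          have := h4 l
          have := h2 l.succ
          omega
        have v3 : ∀ l l' : Fin r, l < l' → j l.succ - 3 + 3 ≤ j l'.succ - 3 := fun l l' hl => by
          have := h4 l
          have := h3 l.succ l'.succ (Fin.succ_lt_succ_iff.2 hl)
          omega
        obtain ⟨p1, p2, -⟩ := ih α β hα hβ m (fun l => j l.succ - 3) y hy v1 v2 v3
        obtain ⟨q1, q2, q3⟩ :=
          ih α β hα hβ m (fun l => j l.succ - 3) (y + 1) (by positivity) v1 v2 v3
        rw [show m + 2 + 1 = m + 3 from rfl, thirdDiagQ_add_three hα hβ m j hy h0 h4,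
          thirdDiagMain_add_three m j (1 / α) y h0 (fun l => by have := h4 l; omega)]
        set p := thirdDiagQ α β m (fun l : Fin r => j l.succ - 3) y
        set q := thirdDiagQ α β m (fun l : Fin r => j l.succ - 3) (y + 1)
        set w := thirdDiagMain m (fun l : Fin r => j l.succ - 3) (1 / α) (y + 1)
        have ha : 0 < 1 / α := by positivity
        have hm : (0 : ℝ) ≤ m := by positivity
        set t : ℝ := y + 1 / α + m with ht
        have hyt : y ≤ t := by linarith
        have ht0 : 0 < t := by linarith
        rw [show y + 1 / α + ((m + 3 : ℕ) : ℝ) + 3 = t + 6 by push_cast; ring]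
        rw [show y + 1 + 1 / α + (m : ℝ) + 3 = t + 4 by ring] at q2 q3
        have hp := p2.trans (div_pow_le_of_le_two_mul hC (show 0 < t + 6 by linarith)
          (by linarith) r)
        have hq := q2.trans (div_pow_le_of_le_two_mul hC (show 0 < t + 6 by linarith)
          (by linarith) r)
        have hqw := q3.trans (div_pow_le_of_le_two_mul hC (show 0 < t + 6 by linarith)
          (by linarith) (r + 1))
        have c1 : 2 * y / (t * (t + 1) * (t + 2)) ≤ 36 / (t + 6) ^ 2 := by
          rw [div_le_div_iff₀ (by positivity) (by positivity)]
          have : (t + 6) ^ 2 ≤ 18 * ((t + 1) * (t + 2)) := by nlinarith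
          calc 2 * y * (t + 6) ^ 2 ≤ 2 * t * (18 * ((t + 1) * (t + 2))) := by gcongr
            _ = _ := by ring
        have c2 : y / ((t + 1) * (t + 2)) ≤ 3 / (t + 6) := by
          rw [div_le_div_iff₀ (by positivity) (by positivity)]
          nlinarith
        have d1 : 2 * y * p / (t * (t + 1) * (t + 2)) ≤
            36 * (C * 2 ^ r) / (t + 6) ^ (r + 2) := by
          calc 2 * y * p / (t * (t + 1) * (t + 2)) = 2 * y / (t * (t + 1) * (t + 2)) * p := by ring
            _ ≤ 36 / (t + 6) ^ 2 * (C * 2 ^ r / (t + 6) ^ r) := by gcongr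
            _ = _ := by rw [div_mul_div_comm, ← pow_add, add_comm 2 r]
        have d1' : 36 * (C * 2 ^ r) / (t + 6) ^ (r + 2) ≤ 36 * (C * 2 ^ r) / (t + 6) ^ (r + 1) := by
          gcongr
          · linarith
          · norm_num
        have d2 : y * q / ((t + 1) * (t + 2)) ≤ 3 * (C * 2 ^ (r + 1)) / (t + 6) ^ (r + 1) := by
          calc y * q / ((t + 1) * (t + 2)) = y / ((t + 1) * (t + 2)) * q := by ring
            _ ≤ 3 / (t + 6) * (C * 2 ^ r / (t + 6) ^ r) := by gcongr
            _ = 3 * (C * 2 ^ r) / (t + 6) ^ (r + 1) := by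
              rw [div_mul_div_comm, ← pow_succ']
            _ ≤ _ := by
              gcongr
              · norm_num
              · omega
        have d3 : y / ((t + 1) * (t + 2)) * |q - w| ≤
            3 * (C * 2 ^ (r + 1)) / (t + 6) ^ (r + 2) := by
          calc y / ((t + 1) * (t + 2)) * |q - w| ≤
              3 / (t + 6) * (C * 2 ^ (r + 1) / (t + 6) ^ (r + 1)) := by gcongr
            _ = _ := by rw [div_mul_div_comm, ← pow_succ']
        refine ⟨by positivity, ?_, ?_⟩
        · rw [add_div]
          exact add_le_add (d1.trans d1') d2
        · rw [add_div, show 2 * y * p / (t * (t + 1) * (t + 2)) + y * q / ((t + 1) * (t + 2)) -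
            y / ((t + 1) * (t + 2)) * w = 2 * y * p / (t * (t + 1) * (t + 2)) +
            y / ((t + 1) * (t + 2)) * (q - w) by ring]
          refine (abs_add_le _ _).trans (add_le_add ?_ ?_)
          · rwa [abs_of_nonneg (by positivity)]
          · rwa [abs_mul, abs_of_nonneg (by positivity)]
      · have hj : ∀ l, 2 ≤ j l := by
          intro l
          have := h1 0
          refine Fin.cases (by omega) (fun l => ?_) l
          have := hsucc l
          omega
        have := ihn (fun l => j l - 1) (y + 1) (by positivity)
          (fun l => by have := hj l; omega)
          (fun l => by have := hj l; have := h2 l; omega)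
          (fun l l' hl => by have := hj l; have := h3 l l' hl; omega)
        rw [thirdDiagQ_succ hα hβ n j hy hj, thirdDiagMain_succ n j _ y h1]
        rw [show y + 1 / α + ((n + 1 : ℕ) : ℝ) + 3 = y + 1 + 1 / α + (n : ℝ) + 3 by
          push_cast; ring]
        exact this

/-- Asymptotic joint distribution of α's on the third main diagonal: for columns with
consecutive gaps `≥ 3`, the probability differs from the stated product by
`O(1/(n+a+b)^{r+1})` uniformly. -/
theorem alphas_on_third_diagonal_asymptotic (r : ℕ) (hr : 1 ≤ r) :
    ∃ C : ℝ, 0 < C ∧ ∀ n : ℕ, 3 ≤ n → ∀ α β : ℝ, 0 < α → 0 < β →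
      ∀ j : Fin r → ℕ, (∀ l, 1 ≤ j l) → (∀ l, j l ≤ n - 2) → StrictMono j →
      (∀ l : Fin r, ∀ h : (l : ℕ) + 1 < r, j l + 3 ≤ j ⟨(l : ℕ) + 1, h⟩) →
      |stairP n α β (fun S => ∀ l : Fin r, S (n - j l - 1) (j l) = StairSymb.alpha)
        - ∏ l : Fin r,
            (1/β + (j l : ℝ) - 2 * ((l : ℕ) + 1 : ℝ) + 1) /
              (((n : ℝ) + 1/α + 1/β - 2 * ((l : ℕ) + 1 : ℝ) + 1) *
                ((n : ℝ) + 1/α + 1/β - 2 * ((l : ℕ) + 1 : ℝ)))|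
        ≤ C / ((n : ℝ) + 1/α + 1/β) ^ (r + 1) := by
  obtain ⟨C, hC, h⟩ := thirdDiagQ_approx r
  refine ⟨C, hC, fun n hn α β hα hβ j h1 h2 hmono hgap => ?_⟩
  have hgap' : ∀ l l' : Fin r, l < l' → j l + 3 ≤ j l' := by
    intro l l' hl
    have hlt : (l : ℕ) + 1 < r := by have := l'.isLt; have : (l : ℕ) < l' := hl; omega
    refine (hgap l hlt).trans (hmono.monotone ?_)
    rw [Fin.le_def]
    exact hl
  obtain ⟨-, -, h3⟩ := h α β hα hβ n j (1 / β) (by positivity) h1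
    (fun l => by have := h2 l; omega) hgap'
  rw [stairP_thirdDiag hα hβ]
  refine h3.trans ?_
  have ha : 0 < 1 / α := by positivity
  have hb : 0 < 1 / β := by positivity
  exact div_le_div_of_nonneg_left hC.le (by positivity)
    (pow_le_pow_left₀ (by positivity) (by linarith) _)
end
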